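/- arXiv:1411.2790 — 2 statements merged into one kernel-verified Lean document; each statement's English description precedes it below -/
import Mathlib

section
/- Let C47 be the cyclic group of order 47. Then the Noether invariant field ℚ(C47) is not ℚ-rational. -/
open MvPolynomial

noncomputable section

/-- A field extension `K` of `k` is `k`-rational if it is isomorphic, as a `k`-algebra,
to a rational function field `k(x₁, …, xₙ)` in finitely many variables. -/
def IsRational (k K : Type*) [Field k] [Field K] [Algebra k K] : Prop :=
  ∃ n : ℕ, Nonempty (K ≃ₐ[k] FractionRing (MvPolynomial (Fin n) k))

instance fact_prime_23 : Fact (Nat.Prime 23) := ⟨by norm_num⟩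

lemma quadraticChar23_neg_one : quadraticChar (ZMod 23) (-1) = -1 := by decide

lemma int_not_sq_add_mul_sq {n a c : ℤ} (hn : n ∣ 47) (h47 : (47 : ℤ) ∣ n)
    (h : c ^ 2 = -23 * (a ^ 2 - 4 * n)) : False := by
  have h23 : (23 : ℤ) ∣ c := by
    have : Prime (23 : ℤ) := by norm_num
    exact this.dvd_of_dvd_pow ⟨-(a ^ 2 - 4 * n), by rw [h]; ring⟩
  obtain ⟨e, rfl⟩ := h23
  have h' : a ^ 2 + 23 * e ^ 2 = 4 * n := by linarith
  have hpos : 0 ≤ n := by nlinarith [sq_nonneg a, sq_nonneg e]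
  have hn' : n = 47 := Int.dvd_antisymm hpos (by norm_num) hn h47
  subst hn'
  have he : e ≤ 2 := by nlinarith
  have he' : -2 ≤ e := by nlinarith
  have ha : a ≤ 13 := by nlinarith
  have ha' : -13 ≤ a := by nlinarith
  interval_cases e <;> interval_cases a <;> omega

lemma gaussSum_sq_quadraticChar23 {R : Type*} [CommRing R] [IsDomain R] [CharZero R] {ζ : R}
    (hζ : IsPrimitiveRoot ζ 23) :
    gaussSum ((quadraticChar (ZMod 23)).ringHomComp (Int.castRingHom R))
      (AddChar.zmodChar 23 hζ.pow_eq_one) ^ 2 = -23 := by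
  rw [gaussSum_sq]
  · rw [MulChar.ringHomComp_apply, quadraticChar23_neg_one]
    simp
  · rw [MulChar.ringHomComp_ne_one_iff (RingHom.injective_int (Int.castRingHom R))]
    exact quadraticChar_ne_one (by rw [ZMod.ringChar_zmod_n]; decide)
  · exact (quadraticChar_isQuadratic _).comp _
  · exact AddChar.zmodChar_primitive_of_primitive_root 23 hζ

lemma map_gaussSum_quadraticChar23 {R : Type*} [CommRing R] {ζ : R} (hζ : IsPrimitiveRoot ζ 23)
    (f : R →+* R)
    (u : (ZMod 23)ˣ) (hf : f ζ = ζ ^ (u : ZMod 23).val) :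
    ((quadraticChar (ZMod 23) u : ℤ) : R) *
      f (gaussSum ((quadraticChar (ZMod 23)).ringHomComp (Int.castRingHom R))
      (AddChar.zmodChar 23 hζ.pow_eq_one)) =
    gaussSum ((quadraticChar (ZMod 23)).ringHomComp (Int.castRingHom R))
      (AddChar.zmodChar 23 hζ.pow_eq_one) := by
  conv_rhs => rw [← gaussSum_mulShift _ _ u]
  simp only [gaussSum, map_sum, map_mul, MulChar.ringHomComp_apply, eq_intCast, map_intCast]
  refine congrArg _ (Finset.sum_congr rfl fun a _ => congrArg _ ?_)
  rw [AddChar.mulShift_apply, AddChar.zmodChar_apply, AddChar.zmodChar_apply, map_pow, hf,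
    ← pow_mul, ZMod.val_mul, ← pow_mod_orderOf, ← hζ.eq_orderOf]

theorem not_exists_generator_prime_above_47 {R : Type*} [CommRing R] [IsDomain R] [CharZero R]
    (τ : (ZMod 23)ˣ →* (R ≃+* R)) {ζ : R}
    (hζ : IsPrimitiveRoot ζ 23) (hτ : ∀ u, τ u ζ = ζ ^ (u : ZMod 23).val)
    (hfix : ∀ x, (∀ u, τ u x = x) → ∃ n : ℤ, (n : R) = x)
    (χ : R →+* ZMod 47) (d : R) (h47 : d ∣ 47) (hd2 : d ∣ ζ - 2) (hχ : χ d = 0) : False := by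
  classical
  set q : (ZMod 23)ˣ → ℤ := fun u => quadraticChar (ZMod 23) u with hq
  have hq1 : ∀ u, q u = 1 ∨ q u = -1 := fun u => quadraticChar_dichotomy u.ne_zero
  have hqmul : ∀ u v, q (u * v) = q u * q v := fun u v => by
    simp only [hq, Units.val_mul, map_mul]
  set P : ℤ → R := fun i => ∏ u with q u = i, τ u d with hP
  have hPτ : ∀ v i, τ v (P i) = P (q v * i) := by
    intro v i
    rw [hP, map_prod]
    refine Finset.prod_bij (fun u _ => v * u) ?_ ?_ ?_ ?_
    · intro u hu
      simp only [Finset.mem_filter, Finset.mem_univ, true_and] at hu ⊢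
      rw [hqmul, hu]
    · intro u _ u' _ h
      exact mul_left_cancel h
    · intro u hu
      simp only [Finset.mem_filter, Finset.mem_univ, true_and] at hu
      refine ⟨v⁻¹ * u, ?_, by simp⟩
      simp only [Finset.mem_filter, Finset.mem_univ, true_and]
      rw [hqmul, hu, ← mul_assoc, ← hqmul]
      simp [hq]
    · intro u _
      rw [map_mul]
      rfl
  set N : R → R := fun x => ∏ u, τ u x with hN
  have hNfix : ∀ x v, τ v (N x) = N x := by
    intro x v
    rw [hN, map_prod]
    exact Fintype.prod_equiv (Equiv.mulLeft v) _ _ fun u => by simp [map_mul]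
  have hNmul : ∀ x y, N (x * y) = N x * N y := fun x y => by simp [hN, Finset.prod_mul_distrib]
  have hNP : N d = P 1 * P (-1) := by
    rw [hN, hP]
    simp only
    rw [← Finset.prod_filter_mul_prod_filter_not Finset.univ (fun u => q u = 1)]
    refine congrArg _ (Finset.prod_congr (Finset.filter_congr fun u _ => ?_) fun _ _ => rfl)
    rcases hq1 u with h | h <;> simp [h]
  have hNint : ∀ x, ∃ n : ℤ, (n : R) = N x := fun x => hfix _ (hNfix x)
  obtain ⟨n, hn⟩ := hNint d
  set g := gaussSum ((quadraticChar (ZMod 23)).ringHomComp (Int.castRingHom R))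
      (AddChar.zmodChar 23 hζ.pow_eq_one) with hg
  have hgτ : ∀ v, τ v g = (q v : R) * g := by
    intro v
    have := map_gaussSum_quadraticChar23 hζ (τ v : R →+* R) v (hτ v)
    rw [← hg] at this
    conv_rhs => rw [← this]
    rw [← mul_assoc, ← Int.cast_mul]
    rcases hq1 v with h | h <;> simp [hq] at h <;> simp [h, hq]
  obtain ⟨a, ha⟩ := hfix (P 1 + P (-1)) fun v => by
    rw [map_add, hPτ, hPτ]
    rcases hq1 v with h | h <;> simp [h, add_comm]
  obtain ⟨c, hc⟩ := hfix ((P 1 - P (-1)) * g) fun v => by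
    rw [map_mul, map_sub, hPτ, hPτ, hgτ]
    rcases hq1 v with h | h
    · simp [h]
    · simp only [h, mul_one, mul_neg, neg_neg, Int.cast_neg, Int.cast_one]
      ring
  have hcard : Fintype.card (ZMod 23)ˣ = 22 := by
    rw [ZMod.card_units_eq_totient]; decide
  have hχn : ((n : ℤ) : ZMod 47) = 0 := by
    rw [← map_intCast χ, hn, hN]
    simp only
    rw [Finset.prod_eq_mul_prod_sdiff_singleton_of_mem (Finset.mem_univ 1), map_mul]
    simp [hχ]
  have hdvd1 : n ∣ 47 ^ 22 := by
    obtain ⟨y, hy⟩ := h47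
    obtain ⟨m, hm⟩ := hNint y
    refine ⟨m, ?_⟩
    have h := hNmul d y
    rw [← hy, ← hn, ← hm] at h
    have h2 : N 47 = 47 ^ 22 := by
      simp [hN, hcard, fun u => map_ofNat (τ u) 47]
    rw [h2] at h
    exact_mod_cast h
  have hdvd2 : n ∣ 2 ^ 23 - 1 := by
    obtain ⟨y, hy⟩ := hd2
    obtain ⟨m, hm⟩ := hNint y
    refine ⟨m, ?_⟩
    have h := hNmul d y
    rw [← hy, ← hn, ← hm] at h
    have h2 : N (ζ - 2) = 2 ^ 23 - 1 := by
      have h3 := hζ.pow_sub_pow_eq_prod_sub_mul 2 1 (by norm_num)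
      rw [one_pow] at h3
      rw [h3]
      have h4 : Polynomial.nthRootsFinset 23 (1 : R) =
          insert 1 (Finset.univ.image fun u : (ZMod 23)ˣ => ζ ^ (u : ZMod 23).val) := by
        ext x
        rw [Polynomial.mem_nthRootsFinset (by norm_num)]
        simp only [Finset.mem_insert, Finset.mem_image, Finset.mem_univ, true_and]
        constructor
        · intro hx
          obtain ⟨i, hi, rfl⟩ := hζ.eq_pow_of_pow_eq_one hx
          by_cases h0 : i = 0
          · left; simp [h0]
          · right
            have : IsUnit ((i : ℕ) : ZMod 23) := by
              rw [isUnit_iff_ne_zero, Ne, ZMod.natCast_eq_zero_iff]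
              exact fun h => h0 (Nat.eq_zero_of_dvd_of_lt h hi)
            refine ⟨this.unit, ?_⟩
            rw [IsUnit.unit_spec, ZMod.val_cast_of_lt hi]
        · rintro (rfl | ⟨u, rfl⟩)
          · simp
          · rw [← pow_mul, mul_comm, pow_mul, hζ.pow_eq_one, one_pow]
      rw [h4, Finset.prod_insert, Finset.prod_image]
      · have : ∀ u : (ZMod 23)ˣ, (2 : R) - ζ ^ (u : ZMod 23).val * 1 = - τ u (ζ - 2) := by
          intro u
          rw [map_sub, hτ, map_ofNat]; ring
        simp only [this, Finset.prod_neg, Finset.card_univ, hcard, hN]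
        norm_num
      · intro u _ v _ h
        exact Units.ext (ZMod.val_injective _ (hζ.pow_inj (ZMod.val_lt _) (ZMod.val_lt _) h))
      · simp only [Finset.mem_image, Finset.mem_univ, true_and, not_exists]
        intro u h
        rw [hζ.pow_eq_one_iff_dvd] at h
        have := Nat.eq_zero_of_dvd_of_lt h (ZMod.val_lt _)
        rw [ZMod.val_eq_zero] at this
        exact u.ne_zero this
    rw [h2] at h
    exact_mod_cast h
  have hn47 : n ∣ 47 := by
    have := Int.dvd_coe_gcd hdvd1 hdvd2
    exact this.trans (by norm_num)
  refine int_not_sq_add_mul_sq (a := a) (c := c) hn47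
    ((ZMod.intCast_zmod_eq_zero_iff_dvd n 47).mp hχn) ?_
  have hg2 : g ^ 2 = -23 := gaussSum_sq_quadraticChar23 hζ
  have : (c : R) ^ 2 = -23 * ((a : R) ^ 2 - 4 * n) := by
    rw [hc, ha, hn, hNP, mul_pow, hg2]; ring
  exact_mod_cast this

open NumberField IsCyclotomicExtension in
theorem exists_ring_prime_above_47_not_principal (K : Type) [Field K] [NumberField K]
    [IsCyclotomicExtension {23} ℚ K] :
    ∃ (R : Type) (_ : CommRing R) (_ : IsDomain R) (_ : CharZero R) (ζ : R) (χ : R →+* ZMod 47),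
      ζ ^ 23 = 1 ∧ ζ ≠ 1 ∧ χ ζ = 2 ∧ ∀ d : R, d ∣ 47 → d ∣ ζ - 2 → χ d ≠ 0 := by
  have hζ := zeta_spec 23 ℚ K
  have hζ' : IsPrimitiveRoot hζ.toInteger 23 := hζ.toInteger_isPrimitiveRoot
  have hroot : Polynomial.aeval (2 : ZMod 47) (minpoly ℤ hζ.integralPowerBasis.gen) = 0 := by
    rw [hζ.integralPowerBasis_gen]
    have h1 : minpoly ℤ hζ.toInteger = Polynomial.cyclotomic 23 ℤ := by
      rw [← RingOfIntegers.minpoly_coe]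
      exact (Polynomial.cyclotomic_eq_minpoly hζ (by norm_num)).symm
    rw [h1, Polynomial.cyclotomic_prime]
    simp only [map_sum, map_pow, Polynomial.aeval_X]
    decide
  let τ : (ZMod 23)ˣ →* (𝓞 K ≃+* 𝓞 K) :=
    (MulSemiringAction.toRingAut (Gal(K/ℚ)) (𝓞 K)).comp
      (Rat.galEquivZMod 23 K).symm.toMonoidHom
  have hτ : ∀ u x, τ u x = (Rat.galEquivZMod 23 K).symm u • x := fun _ _ => rfl
  have : IsGalois ℚ K := IsCyclotomicExtension.isGalois {23} ℚ K
  refine ⟨𝓞 K, inferInstance, inferInstance, inferInstance, hζ.toInteger,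
    (hζ.integralPowerBasis.lift (2 : ZMod 47) hroot).toRingHom, hζ'.pow_eq_one,
    hζ'.ne_one (by norm_num), ?_, fun d h47 hd2 hχ =>
    not_exists_generator_prime_above_47 τ hζ' ?_ ?_ _ d h47 hd2 hχ⟩
  · have := hζ.integralPowerBasis.lift_gen (2 : ZMod 47) hroot
    rw [hζ.integralPowerBasis_gen] at this
    exact this
  · intro u
    rw [hτ, Rat.galEquivZMod_smul_of_pow_eq 23 K _ hζ'.pow_eq_one,
      MulEquiv.apply_symm_apply]
  · intro x hx
    have h1 : ∀ g : Gal(K/ℚ), g (x : K) = x := by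
      intro g
      have := hx (Rat.galEquivZMod 23 K g)
      rw [hτ, MulEquiv.symm_apply_apply] at this
      exact congrArg (algebraMap (𝓞 K) K) this
    obtain ⟨r, hr⟩ := (IsGalois.mem_bot_iff_fixed (x : K)).mpr h1
    have hr2 : IsIntegral ℤ r := by
      rw [← isIntegral_algebraMap_iff (algebraMap ℚ K).injective]
      exact hr ▸ x.isIntegral_coe
    obtain ⟨n, rfl⟩ := IsIntegrallyClosed.isIntegral_iff.mp hr2
    refine ⟨n, ?_⟩
    apply RingOfIntegers.coe_injective
    have h2 : algebraMap (𝓞 K) K (n : 𝓞 K) = algebraMap ℚ K (algebraMap ℤ ℚ n) := by simp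
    exact h2.trans hr

theorem exists_orbit_representatives {X : Type*} (σ : Equiv.Perm X) {p : ℕ} (hp : p.Prime)
    (hσ : σ ^ p = 1) {R : Type*} [CommRing R] (ζ : R) (hζ : ζ ^ p = 1) :
    ∃ O : Set X, (∀ x, σ x = x ∨ ∃ o ∈ O, ∃ i : ℕ, x = (σ ^ i) o) ∧
      ∀ ψ : O → R, ∃ φ : X → R, (∀ x, φ (σ x) = ζ * φ x) ∧ ∀ o : O, φ o = ψ o := by
  classical
  have hσ' : ∀ x, Function.IsPeriodicPt σ p x := fun x => by
    rw [Function.IsPeriodicPt, Function.IsFixedPt, ← Equiv.Perm.coe_pow, hσ]; rfl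
  have hper : ∀ x, σ x ≠ x → ∀ i j : ℕ, (σ ^ i) x = (σ ^ j) x → ζ ^ i = ζ ^ j := by
    intro x hx i j hij
    have hm : Function.minimalPeriod σ x = p := by
      rcases (Nat.dvd_prime hp).mp (hσ' x).minimalPeriod_dvd with h | h
      · exact absurd (Function.minimalPeriod_eq_one_iff_isFixedPt.mp h) hx
      · exact h
    rw [Equiv.Perm.coe_pow, Equiv.Perm.coe_pow, ← Function.iterate_mod_minimalPeriod_eq,
      ← Function.iterate_mod_minimalPeriod_eq (n := j), hm,
      Function.iterate_eq_iterate_iff_of_lt_minimalPeriod ((Nat.mod_lt _ hp.pos).trans_eq hm.symm)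
        ((Nat.mod_lt _ hp.pos).trans_eq hm.symm)] at hij
    rw [pow_eq_pow_mod i hζ, pow_eq_pow_mod j hζ, hij]
  let out : X → X := fun x => (Quotient.mk (Equiv.Perm.SameCycle.setoid σ) x).out
  have hout : ∀ x, σ.SameCycle (out x) x := fun x =>
    Quotient.exact (s := Equiv.Perm.SameCycle.setoid σ) (Quotient.out_eq _)
  have hout_eq : ∀ x y, σ.SameCycle x y → out x = out y := fun x y h => by
    have : Quotient.mk (Equiv.Perm.SameCycle.setoid σ) x = Quotient.mk _ y := Quotient.sound h
    simp only [out, this]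
  have hex : ∀ x, ∃ i : ℕ, x = (σ ^ i) (out x) := by
    intro x
    obtain ⟨i, hi⟩ := hout x
    refine ⟨(i % p).toNat, ?_⟩
    have h1 : ((i % p).toNat : ℤ) = i % p :=
      Int.toNat_of_nonneg (Int.emod_nonneg _ (by exact_mod_cast hp.ne_zero))
    conv_lhs => rw [← hi]
    rw [← zpow_natCast, h1, zpow_eq_zpow_emod' i hσ]
  choose i hi using hex
  refine ⟨{x | σ x ≠ x ∧ out x = x}, fun x => ?_, fun ψ => ?_⟩
  · by_cases hx : σ x = x
    · exact Or.inl hx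
    · refine Or.inr ⟨out x, ⟨?_, hout_eq _ _ (hout x)⟩, i x, hi x⟩
      exact fun h => hx (((hout x).apply_eq_self_iff).mp h)
  · have hmem : ∀ x, σ x ≠ x → out x ∈ {x | σ x ≠ x ∧ out x = x} := fun x hx =>
      ⟨fun h => hx (((hout x).apply_eq_self_iff).mp h), hout_eq _ _ (hout x)⟩
    refine ⟨fun x => if h : σ x = x then 0 else ζ ^ i x * ψ ⟨out x, hmem x h⟩, ?_, ?_⟩
    · intro x
      by_cases h : σ x = x
      · simp [h]
      · have h' : ¬ σ (σ x) = σ x := fun h' => h (σ.injective h')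
        have ho : out (σ x) = out x := hout_eq _ _ ⟨-1, by simp⟩
        simp only [h, h', dite_false, ho]
        rw [← mul_assoc, ← pow_succ']
        congr 1
        refine hper (out x) (hmem x h).1 _ _ ?_
        have := hi (σ x)
        rw [ho] at this
        rw [← this, pow_succ', Equiv.Perm.mul_apply, ← hi x]
    · rintro ⟨o, ho, ho'⟩
      simp only [ho, dite_false, ho']
      have : ζ ^ i o = ζ ^ 0 := by
        refine hper o ho _ _ ?_
        have := hi o
        rw [ho'] at this
        rw [← this]; rfl
      rw [this, pow_zero, one_mul]

lemma eq_zero_of_eq_zero_on_representatives {X : Type*} {σ : Equiv.Perm X} {O : Set X}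
    (hO : ∀ x, σ x = x ∨ ∃ o ∈ O, ∃ i : ℕ, x = (σ ^ i) o) {R : Type*} [CommRing R] [IsDomain R]
    {ζ : R} (hζ : ζ ≠ 1) {φ : X → R} (hφ : ∀ x, φ (σ x) = ζ * φ x)
    (h : ∀ o : O, φ o = 0) (x : X) : φ x = 0 := by
  rcases hO x with hx | ⟨o, ho, i, rfl⟩
  · have h1 := hφ x
    rw [hx] at h1
    have : (ζ - 1) * φ x = 0 := by rw [sub_mul, ← h1]; ring
    exact (mul_eq_zero.mp this).resolve_left (sub_ne_zero.mpr hζ)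
  · induction i with
    | zero => exact h ⟨o, ho⟩
    | succ i ih => rw [pow_succ', Equiv.Perm.mul_apply, hφ, ih, mul_zero]

theorem lattice_contradiction {S T : Type*} [Fintype S] [Fintype T] (σS : Equiv.Perm S)
    (σT : Equiv.Perm T) (hS : σS ^ 23 = 1) (hT : σT ^ 23 = 1) (w : T → ZMod 47)
    (hw : ∀ t, w (σT t) = 2 * w t) (hw0 : ∃ t, w t ≠ 0)
    (F : S → T → ℤ) (hF : ∀ s t, F (σS s) (σT t) = F s t)
    (hinj : ∀ n : S → ℤ, (∀ t, ∑ s, n s * F s t = 0) → n = 0)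
    (hker : ∀ m : T → ℤ, (∃ n : S → ℤ, ∀ t, m t = ∑ s, n s * F s t) ↔
      ∑ t, (m t : ZMod 47) * w t = 0) : False := by
  classical
  have hχ1 : (2 : ZMod 47) ≠ 1 := by decide
  have h47z : ((47 : ℤ) : ZMod 47) = 0 := by decide
  have : Fact (Nat.Prime 47) := ⟨by norm_num⟩
  have : IsCyclotomicExtension {23} ℚ (CyclotomicField 23 ℚ) := by
    convert CyclotomicField.isCyclotomicExtension 23 ℚ
    · rfl
    · exact Subsingleton.elim _ _
  obtain ⟨R, _, _, _, ζ, χ, hζ, hζ1, hχ, hmain⟩ :=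
    exists_ring_prime_above_47_not_principal (CyclotomicField 23 ℚ)
  obtain ⟨OS, hOS, hexS⟩ := exists_orbit_representatives σS (by norm_num) hS ζ hζ
  obtain ⟨OT, hOT, hexT⟩ := exists_orbit_representatives σT (by norm_num) hT ζ hζ
  choose φS hφS hφS' using fun s : OS => hexS (Pi.single s 1)
  choose φT hφT hφT' using fun t : OT => hexT (Pi.single t 1)
  -- expansion of equivariant functions in the bases `φS`, `φT`
  have expS : ∀ φ : S → R, (∀ x, φ (σS x) = ζ * φ x) → ∀ x, ∑ o, φS o x * φ o = φ x := by
    intro φ hφ x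
    rw [← sub_eq_zero]
    refine eq_zero_of_eq_zero_on_representatives (φ := fun x => ∑ o, φS o x * φ o - φ x)
      hOS hζ1 (fun x => ?_) (fun o => ?_) x
    · simp only [hφS, hφ, mul_sub, Finset.mul_sum, mul_assoc]
    · simp [hφS', Pi.single_apply]
  have expT : ∀ φ : T → R, (∀ x, φ (σT x) = ζ * φ x) → ∀ x, ∑ o, φT o x * φ o = φ x := by
    intro φ hφ x
    rw [← sub_eq_zero]
    refine eq_zero_of_eq_zero_on_representatives (φ := fun x => ∑ o, φT o x * φ o - φ x)
      hOT hζ1 (fun x => ?_) (fun o => ?_) x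
    · simp only [hφT, hφ, mul_sub, Finset.mul_sum, mul_assoc]
    · simp [hφT', Pi.single_apply]
  have expw : ∀ t, ∑ o, χ (φT o t) * w o = w t := by
    intro t
    rw [← sub_eq_zero]
    refine eq_zero_of_eq_zero_on_representatives (φ := fun x => ∑ o, χ (φT o x) * w o - w x)
      hOT hχ1 (fun x => ?_) (fun o => ?_) t
    · simp only [hφT, map_mul, hχ, hw, mul_sub, Finset.mul_sum, mul_assoc]
    · simp [hφT', Pi.single_apply, apply_ite χ]
  let f : (T → R) → S → R := fun φ s => ∑ t, (F s t : R) * φ t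
  have hf : ∀ φ : T → R, (∀ x, φ (σT x) = ζ * φ x) → ∀ s, f φ (σS s) = ζ * f φ s := by
    intro φ hφ s
    simp only [f]
    rw [← Equiv.sum_comp σT, Finset.mul_sum]
    refine Finset.sum_congr rfl fun t _ => ?_
    rw [hF, hφ]; ring
  let A : Matrix OS OT R := Matrix.of fun s o => f (φT o) s
  let Bm : (OT → S → ℤ) → Matrix OT OS R :=
    fun n => Matrix.of fun o s => ∑ s', (n o s' : R) * φS s s'
  have hA : ∀ s o, A s o = f (φT o) s := fun _ _ => rfl
  have hB : ∀ n o s, Bm n o s = ∑ s', (n o s' : R) * φS s s' := fun _ _ _ => rfl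
  have hBA : ∀ (n : OT → S → ℤ) (o o' : OT), (Bm n * A) o o' =
      ∑ t, ((∑ s, n o s * F s t : ℤ) : R) * φT o' t := by
    intro n o o'
    simp only [Matrix.mul_apply, hB, hA, Finset.sum_mul]
    rw [Finset.sum_comm]
    simp only [mul_assoc, ← Finset.mul_sum]
    simp only [expS _ (hf _ (hφT o'))]
    simp only [f, Finset.mul_sum]
    rw [Finset.sum_comm]
    simp only [Int.cast_sum, Int.cast_mul, Finset.sum_mul, mul_assoc]
  -- every multiple of `47` is in the row lattice
  have h47 : ∀ t : T, ∃ n : S → ℤ, ∀ t', (if t = t' then 47 else 0) = ∑ s, n s * F s t' := by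
    intro t
    rw [hker fun t' => if t = t' then 47 else 0]
    simp only [Int.cast_ite, ite_mul, Finset.sum_ite_eq, Finset.mem_univ, if_true, Int.cast_zero,
      zero_mul]
    rw [h47z, zero_mul]
  choose N hN using h47
  have hN' : ∀ s s', ∑ t, F s t * N t s' = if s = s' then 47 else 0 := by
    intro s s'
    have := hinj (fun s' => ∑ t, F s t * N t s' - if s = s' then 47 else 0) fun t' => by
      simp only [sub_mul, Finset.sum_sub_distrib, Finset.sum_mul]
      rw [Finset.sum_comm]
      simp only [mul_assoc, ← Finset.mul_sum, ← hN]
      simp [mul_comm]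
    exact sub_eq_zero.mp (congrFun this s')
  have hNσ : ∀ t s, N (σT t) (σS s) = N t s := by
    intro t s
    have := hinj (fun s => N (σT t) (σS s) - N t s) fun t' => by
      simp only [sub_mul, Finset.sum_sub_distrib, ← hN]
      rw [← Finset.sum_congr rfl fun s _ => congrArg _ (hF s t'),
        Equiv.sum_comp σS fun s => N (σT t) s * F s (σT t'), ← hN]
      simp
    exact sub_eq_zero.mp (congrFun this s)
  have h47R : (47 : R) ≠ 0 := by exact_mod_cast (by norm_num : (47 : ℕ) ≠ 0)
  have hBA47 : Bm (fun o => N o) * A = (47 : R) • 1 := by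
    ext o o'
    rw [hBA]
    simp [← hN, hφT', Pi.single_apply, Matrix.one_apply]
  have hAB47 : A * Bm (fun o => N o) = (47 : R) • 1 := by
    ext s s'
    have hNφ : ∀ t, ∑ s'', (N (σT t) s'' : R) * φS s' s'' =
        ζ * ∑ s'', (N t s'' : R) * φS s' s'' := by
      intro t
      rw [← Equiv.sum_comp σS, Finset.mul_sum]
      refine Finset.sum_congr rfl fun t _ => ?_
      rw [hNσ, hφS]; ring
    simp only [Matrix.mul_apply, hB, hA, f, Finset.sum_mul]
    rw [Finset.sum_comm]
    simp only [mul_assoc, ← Finset.mul_sum]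
    have := expT (fun t => ∑ s'', (N t s'' : R) * φS s' s'') hNφ
    simp only [this]
    simp only [Finset.mul_sum]
    rw [Finset.sum_comm]
    simp only [← mul_assoc, ← Finset.sum_mul, ← Int.cast_mul, ← Int.cast_sum, hN']
    simp [hφS', Pi.single_apply, Matrix.one_apply]
  have hcard : Fintype.card OS = Fintype.card OT := by
    refine le_antisymm ?_ ?_
    · refine card_le_of_injective R (Matrix.mulVecLin (Bm fun o => N o)) fun x y hxy => ?_
      have := congrArg (A.mulVec) hxy
      simp only [Matrix.mulVecLin_apply, Matrix.mulVec_mulVec, hAB47, Matrix.smul_mulVec,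
        Matrix.one_mulVec] at this
      exact smul_right_injective _ h47R this
    · refine card_le_of_injective R (Matrix.mulVecLin A) fun x y hxy => ?_
      have := congrArg (Matrix.mulVec (Bm fun o => N o)) hxy
      simp only [Matrix.mulVecLin_apply, Matrix.mulVec_mulVec, hBA47, Matrix.smul_mulVec,
        Matrix.one_mulVec] at this
      exact smul_right_injective _ h47R this
  let e : OS ≃ OT := Fintype.equivOfCardEq hcard
  let d : R := (A.submatrix e.symm id).det
  obtain ⟨o₁, ho₁⟩ : ∃ o : OT, w o ≠ 0 := by
    by_contra! h
    obtain ⟨t, ht⟩ := hw0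
    exact ht (eq_zero_of_eq_zero_on_representatives hOT hχ1 hw h t)
  -- determinant divisibility
  have hdvd : ∀ (m : T → ℤ) (κ : R), (∑ t, (m t : ZMod 47) * w t = 0) →
      (∀ o, ∑ t, (m t : R) * φT o t = if o = o₁ then κ else 0) → d ∣ κ := by
    intro m κ hm hκ
    let c : OT → ℤ := fun o => ((- w o * (w o₁)⁻¹ : ZMod 47).val : ℤ)
    have hc : ∀ o, (c o : ZMod 47) = - w o * (w o₁)⁻¹ := fun o => by simp [c]
    let E : OT → T → ℤ := fun o t => if o = o₁ then m t else
      (if (o : T) = t then 1 else 0) + c o * (if (o₁ : T) = t then 1 else 0)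
    have hE : ∀ o, ∃ n : S → ℤ, ∀ t, E o t = ∑ s, n s * F s t := by
      intro o
      rw [hker]
      by_cases h : o = o₁
      · simpa [E, h] using hm
      · simp only [E, h, if_false]
        push_cast
        simp [add_mul, Finset.sum_add_distrib, hc, mul_assoc, ho₁]
    choose n hn using hE
    have key : Bm n * A =
        (1 : Matrix OT OT R).updateCol o₁ fun o => if o = o₁ then κ else c o := by
      ext o o'
      rw [hBA]
      simp only [← hn, Matrix.updateCol_apply, Matrix.one_apply]
      by_cases h : o = o₁
      · subst h
        simp only [E, if_true, hκ]
        split_ifs with h' h''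
        · rfl
        · exact absurd h''.symm h'
        · rfl
      · simp only [E, h, if_false]
        simp [add_mul, Finset.sum_add_distrib, hφT', Pi.single_apply]
        by_cases h' : o' = o₁
        · simp [h', h]
        · simp [h', Ne.symm h']
    have hdet : (Bm n * A).det = κ := by
      rw [key, ← Matrix.cramer_apply, Matrix.cramer_one]
      simp
    rw [← hdet, ← Matrix.submatrix_id_id (Bm n * A),
      ← Matrix.submatrix_mul_equiv (Bm n) A id e.symm id, Matrix.det_mul]
    exact dvd_mul_left _ _
  have hd1 : d ∣ 47 := by
    refine hdvd (fun t => if (o₁ : T) = t then 47 else 0) 47 ?_ fun o => ?_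
    · simp only [Int.cast_ite, ite_mul, Finset.sum_ite_eq, Finset.mem_univ, if_true, Int.cast_zero,
        zero_mul, h47z]
    · simp [hφT', Pi.single_apply, eq_comm]
  have hd2 : d ∣ ζ - 2 := by
    refine hdvd (fun t => (if σT o₁ = t then 1 else 0) - 2 * (if (o₁ : T) = t then 1 else 0))
      (ζ - 2) ?_ fun o => ?_
    · push_cast
      simp [sub_mul, hw]
    · push_cast
      simp only [sub_mul, mul_assoc, ite_mul, one_mul, zero_mul, Finset.sum_sub_distrib,
        Finset.sum_ite_eq, Finset.mem_univ, if_true, hφT, ← Finset.mul_sum, hφT',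
        Pi.single_apply, eq_comm (a := o₁)]
      split_ifs <;> ring
  refine hmain d hd1 hd2 ?_
  rw [RingHom.map_det]
  refine Matrix.exists_mulVec_eq_zero_iff.mp ⟨fun o => w o, ?_, ?_⟩
  · exact fun h => ho₁ (congrFun h o₁)
  · ext o
    simp only [Matrix.mulVec, dotProduct, RingHom.mapMatrix_apply, Matrix.map_apply,
      Matrix.submatrix_apply, hA, f, id, map_sum, map_mul, map_intCast, Finset.sum_mul]
    rw [Finset.sum_comm]
    simp only [mul_assoc, ← Finset.mul_sum, expw]
    refine (hker _).mp ⟨fun s => if s = e.symm o then 1 else 0, fun t => by simp⟩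

/-- `u` and `v` differ by the image of a unit of `D`. -/
def UnitEq {D Ω : Type*} [CommRing D] [Field Ω] (α : D →+* Ω) (u v : Ω) : Prop :=
  ∃ c : Dˣ, u = α c * v

namespace UnitEq

variable {D Ω : Type*} [CommRing D] [Field Ω] {α : D →+* Ω} {u v u' v' x : Ω}

lemma refl (α : D →+* Ω) (u : Ω) : UnitEq α u u := ⟨1, by simp⟩

lemma symm (h : UnitEq α u v) : UnitEq α v u := by
  obtain ⟨c, rfl⟩ := h
  exact ⟨c⁻¹, by rw [← mul_assoc, ← map_mul, Units.inv_mul, map_one, one_mul]⟩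

lemma trans (h : UnitEq α u v) (h' : UnitEq α v x) : UnitEq α u x := by
  obtain ⟨c, rfl⟩ := h
  obtain ⟨c', rfl⟩ := h'
  exact ⟨c * c', by simp [mul_assoc]⟩

lemma mul (h : UnitEq α u v) (h' : UnitEq α u' v') : UnitEq α (u * u') (v * v') := by
  obtain ⟨c, rfl⟩ := h
  obtain ⟨c', rfl⟩ := h'
  exact ⟨c * c', by simp only [Units.val_mul, map_mul]; ring⟩

lemma inv (h : UnitEq α u v) : UnitEq α u⁻¹ v⁻¹ := by
  obtain ⟨c, rfl⟩ := h
  refine ⟨c⁻¹, ?_⟩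
  have : α c * α ((c⁻¹ : Dˣ) : D) = 1 := by rw [← map_mul, Units.mul_inv, map_one]
  rw [mul_inv, ← eq_inv_of_mul_eq_one_right this]

lemma pow (h : UnitEq α u v) (n : ℕ) : UnitEq α (u ^ n) (v ^ n) := by
  obtain ⟨c, rfl⟩ := h
  exact ⟨c ^ n, by simp [mul_pow]⟩

lemma zpow (h : UnitEq α u v) (n : ℤ) : UnitEq α (u ^ n) (v ^ n) := by
  cases n with
  | ofNat n => simpa using h.pow n
  | negSucc n => simpa [zpow_negSucc] using (h.pow (n + 1)).inv

lemma prod {ι : Type*} (s : Finset ι) {f g : ι → Ω} (h : ∀ i, UnitEq α (f i) (g i)) :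
    UnitEq α (∏ i ∈ s, f i) (∏ i ∈ s, g i) := by
  classical
  induction s using Finset.induction_on with
  | empty => exact refl _ _
  | insert a s ha ih => rw [Finset.prod_insert ha, Finset.prod_insert ha]; exact (h a).mul ih

lemma map {τD : D →+* D} {τ : Ω →+* Ω} (hτ : ∀ x, α (τD x) = τ (α x)) (h : UnitEq α u v) :
    UnitEq α (τ u) (τ v) := by
  obtain ⟨c, rfl⟩ := h
  exact ⟨Units.map τD c, by simp [hτ]⟩

lemma of_associated {a b : D} (h : Associated a b) : UnitEq α (α a) (α b) := by
  obtain ⟨c, rfl⟩ := h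
  exact symm ⟨c, by rw [map_mul, mul_comm]⟩

lemma associated {a b : D} (hα : Function.Injective α) (h : UnitEq α (α a) (α b)) :
    Associated a b := by
  obtain ⟨c, h⟩ := h.symm
  rw [← map_mul] at h
  exact ⟨c, by rw [hα h, mul_comm]⟩

end UnitEq

lemma zpow_sum_of_ne_zero {Ω ι : Type*} [Field Ω] {x : Ω} (hx : x ≠ 0) (s : Finset ι)
    (f : ι → ℤ) : x ^ (∑ i ∈ s, f i) = ∏ i ∈ s, x ^ f i := by
  classical
  induction s using Finset.induction_on with
  | empty => simp
  | insert a s ha ih => rw [Finset.sum_insert ha, Finset.prod_insert ha, zpow_add₀ hx, ih]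

/-- The localization of `α(D)` at the powers of `d`, inside the field `Ω`. -/
def awaySubring {D Ω : Type*} [CommRing D] [Field Ω] (α : D →+* Ω) (d : D) : Subring Ω where
  carrier := {u | ∃ (k : ℕ) (y : D), α d ^ k * u = α y}
  mul_mem' := by
    rintro u v ⟨k, y, h⟩ ⟨l, z, h'⟩
    exact ⟨k + l, y * z, by rw [map_mul, ← h, ← h']; ring⟩
  one_mem' := ⟨0, 1, by simp⟩
  add_mem' := by
    rintro u v ⟨k, y, h⟩ ⟨l, z, h'⟩
    exact ⟨k + l, d ^ l * y + d ^ k * z, by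
      rw [map_add, map_mul, map_mul, ← h, ← h', map_pow, map_pow]; ring⟩
  zero_mem' := ⟨0, 0, by simp⟩
  neg_mem' := by
    rintro u ⟨k, y, h⟩
    exact ⟨k, -y, by rw [map_neg, ← h]; ring⟩

lemma map_mem_awaySubring {D Ω : Type*} [CommRing D] [Field Ω] (α : D →+* Ω) (d y : D) :
    α y ∈ awaySubring α d := ⟨0, y, by simp⟩

/-- `p` is a family of representatives of the classes of primes dividing `d`. -/
structure PrimeReps {S D : Type*} [CommRing D] (p : S → D) (d : D) : Prop where
  prime : ∀ s, Prime (p s)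
  dvd : ∀ s, p s ∣ d
  eq_of_associated : ∀ s t, Associated (p s) (p t) → s = t
  exists_associated : ∀ q, Prime q → q ∣ d → ∃ s, Associated q (p s)

theorem exists_primeReps {D : Type*} [CommRing D] [IsDomain D] [UniqueFactorizationMonoid D]
    {d : D} (hd : d ≠ 0) : ∃ (S : Set D) (_ : Fintype S) (p : S → D), PrimeReps p d := by
  classical
  let _ : NormalizationMonoid D := Classical.choice inferInstance
  refine ⟨((UniqueFactorizationMonoid.normalizedFactors d).toFinset : Set D), inferInstance,
    fun s => s, ?_, ?_, ?_, ?_⟩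
  · exact fun s => UniqueFactorizationMonoid.prime_of_normalized_factor _
      (Multiset.mem_toFinset.mp s.2)
  · exact fun s => UniqueFactorizationMonoid.dvd_of_mem_normalizedFactors
      (Multiset.mem_toFinset.mp s.2)
  · intro s t h
    have hs := UniqueFactorizationMonoid.normalize_normalized_factor _
      (Multiset.mem_toFinset.mp s.2)
    have ht := UniqueFactorizationMonoid.normalize_normalized_factor _
      (Multiset.mem_toFinset.mp t.2)
    rw [← normalize_eq_normalize_iff_associated, hs, ht] at h
    exact Subtype.ext h
  · intro q hq hqd
    obtain ⟨s, hs, hs'⟩ :=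
      UniqueFactorizationMonoid.exists_mem_normalizedFactors_of_dvd hd hq.irreducible hqd
    exact ⟨⟨s, Multiset.mem_toFinset.mpr hs⟩, hs'⟩

namespace PrimeReps

variable {S D Ω : Type*} [CommRing D] [Field Ω] {p : S → D} {d : D}

/-- The Laurent monomial with exponents `n` in the primes `p`. -/
def mon [Fintype S] (α : D →+* Ω) (p : S → D) (n : S → ℤ) : Ω := ∏ s, α (p s) ^ n s

lemma map_ne_zero (h : PrimeReps p d) {α : D →+* Ω} (hα : Function.Injective α) (s : S) :
    α (p s) ≠ 0 := (map_ne_zero_iff α hα).mpr (h.prime s).ne_zero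

lemma mon_ne_zero [Fintype S] (h : PrimeReps p d) {α : D →+* Ω} (hα : Function.Injective α)
    (n : S → ℤ) :
    mon α p n ≠ 0 := Finset.prod_ne_zero_iff.mpr fun s _ => zpow_ne_zero _ (h.map_ne_zero hα s)

lemma mon_sub [Fintype S] (h : PrimeReps p d) {α : D →+* Ω} (hα : Function.Injective α)
    (n m : S → ℤ) :
    mon α p (n - m) = mon α p n * (mon α p m)⁻¹ := by
  simp only [mon, ← Finset.prod_inv_distrib, ← Finset.prod_mul_distrib]
  exact Finset.prod_congr rfl fun s _ => by
    rw [Pi.sub_apply, zpow_sub₀ (h.map_ne_zero hα s), div_eq_mul_inv]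

lemma mon_sum_mul [Fintype S] (h : PrimeReps p d) {α : D →+* Ω} (hα : Function.Injective α)
    {ι : Type*}
    [Fintype ι] (m : ι → ℤ) (n : ι → S → ℤ) :
    mon α p (fun s => ∑ i, m i * n i s) = ∏ i, mon α p (n i) ^ m i := by
  simp only [mon, ← Finset.prod_zpow]
  rw [Finset.prod_comm]
  refine Finset.prod_congr rfl fun s _ => ?_
  rw [zpow_sum_of_ne_zero (h.map_ne_zero hα s)]
  exact Finset.prod_congr rfl fun i _ => by rw [mul_comm, zpow_mul]

lemma exists_unitEq_of_dvd_pow [Fintype S] [IsDomain D] [UniqueFactorizationMonoid D]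
    (h : PrimeReps p d) (hd : d ≠ 0)
    {α : D →+* Ω} (hα : Function.Injective α) (x : D) :
    ∀ k : ℕ, x ∣ d ^ k → ∃ n : S → ℤ, UnitEq α (α x) (mon α p n) := by
  classical
  induction x using UniqueFactorizationMonoid.induction_on_prime with
  | h₁ => exact fun k hk => absurd (zero_dvd_iff.mp hk) (pow_ne_zero _ hd)
  | h₂ x hx => exact fun k hk => ⟨0, hx.unit, by simp [mon]⟩
  | h₃ x q hx hq ih =>
    intro k hk
    obtain ⟨n, hn⟩ := ih k ((dvd_mul_left _ _).trans hk)
    obtain ⟨s, hs⟩ := h.exists_associated q hq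
      (hq.dvd_of_dvd_pow ((dvd_mul_right _ _).trans hk))
    refine ⟨n + Pi.single s 1, ?_⟩
    have : mon α p (n + Pi.single s 1) = α (p s) * mon α p n := by
      have h1 : mon α p (Pi.single s 1) = α (p s) := by
        rw [mon, Finset.prod_eq_single s] <;> simp +contextual
      have h2 := h.mon_sub hα (n + Pi.single s 1) (Pi.single s 1)
      rw [add_sub_cancel_right, h1] at h2
      rw [h2]
      field_simp [h.map_ne_zero hα s]
    rw [this, map_mul]
    exact (UnitEq.of_associated hs).mul hn

theorem exists_unitEq_mon [Fintype S] [IsDomain D] [UniqueFactorizationMonoid D]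
    (h : PrimeReps p d) (hd : d ≠ 0)
    {α : D →+* Ω} (hα : Function.Injective α) {u : Ω} (hu0 : u ≠ 0) (hu : u ∈ awaySubring α d)
    (hu' : u⁻¹ ∈ awaySubring α d) : ∃ n : S → ℤ, UnitEq α u (mon α p n) := by
  obtain ⟨k, x, hx⟩ := hu
  obtain ⟨l, y, hy⟩ := hu'
  have hxy : x * y = d ^ (k + l) := by
    apply hα
    rw [map_mul, ← hx, ← hy, map_pow]
    field_simp
    ring
  obtain ⟨n, hn⟩ := h.exists_unitEq_of_dvd_pow hd hα x (k + l) ⟨y, hxy.symm⟩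
  obtain ⟨m, hm⟩ := h.exists_unitEq_of_dvd_pow hd hα (d ^ k) k dvd_rfl
  refine ⟨n - m, ?_⟩
  rw [h.mon_sub hα]
  have : u = α x * (α (d ^ k))⁻¹ := by
    have h0 : α d ≠ 0 := (map_ne_zero_iff α hα).mpr hd
    rw [← hx, map_pow]
    field_simp
  rw [this]
  exact hn.mul hm.inv

theorem mon_injective [Fintype S] [IsDomain D] (h : PrimeReps p d) {α : D →+* Ω}
    (hα : Function.Injective α) {n m : S → ℤ}
    (hnm : UnitEq α (mon α p n) (mon α p m)) : n = m := by
  classical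
  have key : ∀ n m : S → ℤ, UnitEq α (mon α p n) (mon α p m) → ∀ s, n s ≤ m s := by
    intro n m hnm s
    by_contra! hlt
    have h1 : UnitEq α (α (∏ t, p t ^ (n t - m t).toNat)) (α (∏ t, p t ^ (m t - n t).toNat)) := by
      have h2 := hnm.mul (UnitEq.refl α (mon α p m * mon α p n)⁻¹)
      have h3 := h2.mul (UnitEq.refl α (mon α p fun t => max (n t) (m t)))
      convert h3 using 1
      all_goals
        simp only [mon, map_prod, map_pow, ← Finset.prod_mul_distrib, ← Finset.prod_inv_distrib]
        refine Finset.prod_congr rfl fun t _ => ?_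
        have h0 := h.map_ne_zero hα t
        rw [← zpow_natCast, ← zpow_add₀ h0, ← zpow_neg, ← zpow_add₀ h0, ← zpow_add₀ h0]
        congr 1
        omega
    have h2 := h1.associated hα
    have h3 : p s ∣ ∏ t, p t ^ (m t - n t).toNat := by
      refine dvd_trans ?_ h2.dvd
      refine dvd_trans (dvd_pow_self _ ?_) (Finset.dvd_prod_of_mem _ (Finset.mem_univ s))
      omega
    obtain ⟨t, -, ht⟩ := (h.prime s).exists_mem_finset_dvd h3
    have h4 := (h.prime s).dvd_of_dvd_pow ht
    have hst := h.eq_of_associated s t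
      ((h.prime s).associated_of_dvd (h.prime t) h4)
    subst hst
    have h5 : (m s - n s).toNat = 0 := by omega
    rw [h5, pow_zero] at ht
    exact (h.prime s).not_isUnit (isUnit_of_dvd_one ht)
  exact funext fun s => le_antisymm (key n m hnm s) (key m n hnm.symm s)

lemma mon_mem [Fintype S] (h : PrimeReps p d) {α : D →+* Ω} (hα : Function.Injective α)
    (n : S → ℤ) : mon α p n ∈ awaySubring α d := by
  refine Subring.prod_mem _ fun s _ => ?_
  have h1 : (α (p s))⁻¹ ∈ awaySubring α d := by
    obtain ⟨y, hy⟩ := h.dvd s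
    refine ⟨1, y, ?_⟩
    have h0 := h.map_ne_zero hα s
    rw [pow_one, hy, map_mul]
    field_simp
  cases n s with
  | ofNat k => simpa using Subring.pow_mem _ (map_mem_awaySubring α d (p s)) k
  | negSucc k => simpa [zpow_negSucc] using Subring.pow_mem _ h1 (k + 1)

lemma exists_perm [Fintype S] (h : PrimeReps p d) (τ : D ≃+* D) (hτ : τ d = d) :
    ∃ e : Equiv.Perm S, ∀ s, Associated (τ (p s)) (p (e s)) := by
  have hτp : ∀ s, ∃ t, Associated (τ (p s)) (p t) := fun s =>
    h.exists_associated _ ((MulEquiv.prime_iff τ).mpr (h.prime s)) (hτ ▸ map_dvd τ (h.dvd s))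
  choose e he using hτp
  have hinj : Function.Injective e := by
    intro s t hst
    refine h.eq_of_associated s t ?_
    have h1 := (he s).trans (hst ▸ (he t).symm)
    simpa using h1.map τ.symm
  exact ⟨Equiv.ofBijective e (Finite.injective_iff_bijective.mp hinj), he⟩

lemma perm_comp (h : PrimeReps p d) {τ τ' : D ≃+* D} {e e' f : Equiv.Perm S}
    (he : ∀ s, Associated (τ (p s)) (p (e s))) (he' : ∀ s, Associated (τ' (p s)) (p (e' s)))
    (hf : ∀ s, Associated (τ (τ' (p s))) (p (f s))) : f = e * e' :=
  Equiv.ext fun s => h.eq_of_associated _ _ ((hf s).symm.trans (((he' s).map τ).trans (he _)))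

lemma perm_pow (h : PrimeReps p d) {τ : D ≃+* D} {e : Equiv.Perm S}
    (he : ∀ s, Associated (τ (p s)) (p (e s))) {k : ℕ} (hk : ∀ x, τ^[k] x = x) : e ^ k = 1 := by
  have : ∀ (k : ℕ) s, Associated (τ^[k] (p s)) (p ((e ^ k) s)) := by
    intro k
    induction k with
    | zero => exact fun s => Associated.refl _
    | succ k ih =>
      intro s
      rw [Function.iterate_succ_apply', pow_succ', Equiv.Perm.mul_apply]
      exact ((ih s).map τ).trans (he _)
  exact Equiv.ext fun s => h.eq_of_associated _ _ ((this k s).symm.trans (by rw [hk]; rfl))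

lemma unitEq_map_mon [Fintype S] {α : D →+* Ω} {τD : D ≃+* D} {τ : Ω ≃+* Ω}
    (hτ : ∀ x, α (τD x) = τ (α x))
    {e : Equiv.Perm S} (he : ∀ s, Associated (τD (p s)) (p (e s))) (n : S → ℤ) :
    UnitEq α (τ (mon α p n)) (mon α p fun s => n (e.symm s)) := by
  simp only [mon, map_prod, map_zpow₀]
  rw [← Equiv.prod_comp e fun s => α (p s) ^ n (e.symm s)]
  refine UnitEq.prod _ fun s => ?_
  rw [Equiv.symm_apply_apply, ← hτ]
  exact (UnitEq.of_associated (he s)).zpow _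

end PrimeReps

open PrimeReps in
theorem false_of_awaySubring_invariants {D B Ω : Type*} [CommRing D] [IsDomain D]
    [UniqueFactorizationMonoid D] [CommRing B] [IsDomain B] [UniqueFactorizationMonoid B] [Field Ω]
    {α : D →+* Ω} (hα : Function.Injective α) {β : B →+* Ω} (hβ : Function.Injective β)
    {gD σD : D ≃+* D} {σB : B ≃+* B} {g σ : Ω ≃+* Ω}
    (hgD : ∀ x, α (gD x) = g (α x)) (hσD : ∀ x, α (σD x) = σ (α x))
    (hσB : ∀ x, β (σB x) = σ (β x)) (hgB : ∀ x, g (β x) = β x)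
    (hgD47 : ∀ x, gD^[47] x = x) (hσD23 : ∀ x, σD^[23] x = x) (hσB23 : ∀ x, σB^[23] x = x)
    (hcomm : ∀ x, gD (σD x) = σD (gD x))
    (hU : ∀ u v, UnitEq α u v ↔ UnitEq β u v)
    {a : D} {b : B} (ha : a ≠ 0) (hb : b ≠ 0) (hga : gD a = a) (hσa : σD a = a) (hσb : σB b = b)
    (hβa : ∀ x, β x ∈ awaySubring α a) (hba : (β b)⁻¹ ∈ awaySubring α a)
    (hinv : ∀ u, g u = u → u ∈ awaySubring α a → u ∈ awaySubring β b)
    {ζ : Dˣ} (hζ : IsPrimitiveRoot (α ζ) 47) (hσζ : σ (α ζ) = α ζ ^ 2)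
    {y : D} (hya : y ∣ a) (hy : g (α y) = α ζ * α y) : False := by
  classical
  have hζ0 : α ζ ≠ 0 := hζ.ne_zero (by norm_num)
  have hzpow : ∀ z : ℤ, α ζ ^ z = 1 ↔ (z : ZMod 47) = 0 := fun z => by
    rw [hζ.zpow_eq_one_iff_dvd, ← ZMod.intCast_zmod_eq_zero_iff_dvd]
  have hgu : ∀ c : Dˣ, g (α c) = α c := fun c => by
    obtain ⟨c', hc'⟩ := (hU (α c) 1).mp ⟨c, by simp⟩
    rw [hc', map_mul, hgB, map_one]
  obtain ⟨SA, _, p, hp⟩ := exists_primeReps ha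
  obtain ⟨SB, _, q, hq⟩ := exists_primeReps hb
  obtain ⟨gS, hgS⟩ := hp.exists_perm gD hga
  obtain ⟨σS, hσS⟩ := hp.exists_perm σD hσa
  obtain ⟨σQ, hσQ⟩ := hq.exists_perm σB hσb
  have hσS23 : σS ^ 23 = 1 := hp.perm_pow hσS hσD23
  have hσQ23 : σQ ^ 23 = 1 := hq.perm_pow hσQ hσB23
  have hcommS : Commute gS σS := by
    refine (hp.perm_comp hgS hσS fun s => ?_ : σS * gS = gS * σS).symm
    rw [hcomm]
    exact ((hgS s).map σD).trans (hσS _)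
  let T := Quotient (Equiv.Perm.SameCycle.setoid gS)
  let π : SA → T := Quotient.mk _
  have hπ : Function.Surjective π := Quotient.mk_surjective
  let _ : Fintype T := Fintype.ofFinite T
  let σT : Equiv.Perm T := Quotient.congr σS fun x y => by
    constructor
    · rintro ⟨i, hi⟩
      refine ⟨i, ?_⟩
      rw [← Equiv.Perm.mul_apply, (hcommS.zpow_left i).eq, Equiv.Perm.mul_apply, hi]
    · rintro ⟨i, hi⟩
      refine ⟨i, σS.injective ?_⟩
      rw [← Equiv.Perm.mul_apply, ← (hcommS.zpow_left i).eq, Equiv.Perm.mul_apply, hi]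
  have hσT : ∀ s, σT (π s) = π (σS s) := fun _ => rfl
  have hσT23 : σT ^ 23 = 1 := by
    have : ∀ (k : ℕ) s, (σT ^ k) (π s) = π ((σS ^ k) s) := by
      intro k
      induction k with
      | zero => exact fun _ => rfl
      | succ k ih =>
        exact fun s => by rw [pow_succ', pow_succ', Equiv.Perm.mul_apply, ih, hσT]; rfl
    ext t
    obtain ⟨s, rfl⟩ := hπ t
    rw [this, hσS23]
    rfl
  have hπg : ∀ s, π (gS s) = π s := fun s => Quotient.sound ⟨-1, by simp⟩
  have hlift : ∀ n : SA → ℤ, (∀ s, n (gS s) = n s) → ∃ m : T → ℤ, n = fun s => m (π s) := by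
    intro n hn
    have hn' : ∀ (i : ℤ) s, n ((gS ^ i) s) = n s := by
      intro i
      induction i using Int.induction_on with
      | zero => exact fun _ => rfl
      | succ i ih => exact fun s => by rw [zpow_add_one, Equiv.Perm.mul_apply, ih, hn]
      | pred i ih =>
        intro s
        rw [zpow_sub_one, Equiv.Perm.mul_apply, ih, ← hn]
        exact congrArg n (gS.apply_symm_apply s)
    exact ⟨Quotient.lift n fun x y ⟨i, hi⟩ => by rw [← hi, hn'], rfl⟩
  have hlift' : ∀ (u : Ω) (n : SA → ℤ), UnitEq α u (mon α p n) → UnitEq α (g u) u →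
      ∃ m : T → ℤ, n = fun s => m (π s) := by
    intro u n hn hu
    refine hlift n fun s => ?_
    have h1 := hp.mon_injective hα
      ((hn.symm.trans hu.symm).trans ((hn.map (τD := gD) (τ := g) hgD).trans
        (unitEq_map_mon hgD hgS n)))
    rw [congrFun h1 (gS s), Equiv.symm_apply_apply]
  let M : (T → ℤ) → Ω := fun m => mon α p fun s => m (π s)
  have hMinj : ∀ m m' : T → ℤ, UnitEq α (M m) (M m') → m = m' := by
    intro m m' h
    ext t
    obtain ⟨s, rfl⟩ := hπ t
    exact congrFun (hp.mon_injective hα h) s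
  -- the semi-invariants attached to the `g`-orbits
  let x : T → D := fun o => ∏ s, if π s = o then p s else 1
  have hxM : ∀ o, α (x o) = M (Pi.single o 1) := by
    intro o
    simp only [x, M, mon, map_prod]
    refine Finset.prod_congr rfl fun s _ => ?_
    by_cases h : π s = o <;> simp [h]
  have hx0 : ∀ o, α (x o) ≠ 0 := fun o => hxM o ▸ hp.mon_ne_zero hα _
  have hMx : ∀ m, M m = ∏ o, α (x o) ^ m o := by
    intro m
    simp only [hxM, M]
    rw [← hp.mon_sum_mul hα]
    congr 1
    ext s
    rw [Finset.sum_eq_single (π s)]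
    · simp
    · intro o _ ho
      simp [Ne.symm ho]
    · simp
  have hgx : ∀ o, ∃ i : ℕ, g (α (x o)) = α ζ ^ i * α (x o) := by
    intro o
    have h1 : UnitEq α (g (α (x o))) (α (x o)) := by
      rw [hxM]
      convert unitEq_map_mon hgD hgS _ using 4 with s
      rw [← hπg (gS.symm s), Equiv.apply_symm_apply]
    obtain ⟨c, hc⟩ := h1
    have h2 : ∀ k : ℕ, α (gD^[k] (x o)) = α c ^ k * α (x o) := by
      intro k
      induction k with
      | zero => simp
      | succ k ih =>
        rw [Function.iterate_succ_apply', hgD, ih, map_mul, map_pow, hgu, hc, pow_succ, mul_assoc]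
    have h3 : α c ^ 47 = 1 := by
      have := h2 47
      rw [hgD47] at this
      exact mul_right_cancel₀ (hx0 o) (by rw [← this, one_mul])
    obtain ⟨i, -, hi⟩ := hζ.eq_pow_of_pow_eq_one h3
    exact ⟨i, by rw [hi, hc]⟩
  choose i hi using hgx
  have hgM : ∀ m : T → ℤ, g (M m) = α ζ ^ (∑ o, m o * i o) * M m := by
    intro m
    rw [hMx, map_prod, zpow_sum_of_ne_zero hζ0, ← Finset.prod_mul_distrib]
    refine Finset.prod_congr rfl fun o _ => ?_
    rw [map_zpow₀, hi, mul_zpow, mul_comm (m o), zpow_mul, zpow_natCast]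
  let w : T → ZMod 47 := fun o => i o
  have hgM' : ∀ m : T → ℤ, g (M m) = M m ↔ ∑ t, (m t : ZMod 47) * w t = 0 := by
    intro m
    rw [hgM, mul_eq_right₀ (hp.mon_ne_zero hα _), hzpow]
    simp [w]
  have hw : ∀ t, w (σT t) = 2 * w t := by
    intro t
    have h1 : UnitEq α (σ (α (x t))) (α (x (σT t))) := by
      rw [hxM, hxM]
      convert unitEq_map_mon hσD hσS _ using 3 with s
      obtain ⟨s, rfl⟩ := σS.surjective s
      rw [Equiv.symm_apply_apply, ← hσT]
      simp [Pi.single_apply]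
    obtain ⟨e, he⟩ := h1
    have h2 : g (σ (α (x t))) = σ (g (α (x t))) := by
      rw [← hσD, ← hgD, hcomm, hσD, hgD]
    rw [hi, he, map_mul, hgu, hi, map_mul, map_pow, hσζ, he] at h2
    have h3 : α ζ ^ i (σT t) = α ζ ^ (2 * i t) := by
      have h0 : α e * α (x (σT t)) ≠ 0 := he ▸ (map_ne_zero_iff σ σ.injective).mpr (hx0 t)
      refine mul_right_cancel₀ h0 ?_
      rw [pow_mul, ← h2]
      ring
    have h4 : α ζ ^ ((i (σT t) : ℤ) - ((2 * i t : ℕ) : ℤ)) = 1 := by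
      rw [zpow_sub₀ hζ0, zpow_natCast, zpow_natCast, h3, div_self (pow_ne_zero _ hζ0)]
    rw [hzpow] at h4
    push_cast at h4
    exact sub_eq_zero.mp h4
  have hw0 : ∃ t, w t ≠ 0 := by
    by_contra! h
    obtain ⟨n, hn⟩ := hp.exists_unitEq_of_dvd_pow ha hα y 1 (by simpa using hya)
    obtain ⟨m, rfl⟩ := hlift' _ n hn ⟨ζ, hy⟩
    obtain ⟨c, hc⟩ := hn
    have h1 : g (M m) = M m := (hgM' m).mpr (by simp [h])
    have h2 : α y ≠ 0 := (map_ne_zero_iff α hα).mpr (ne_zero_of_dvd_ne_zero ha hya)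
    have h3 : g (α y) = α y := by rw [hc, map_mul, hgu, h1]
    rw [h3] at hy
    exact hζ.ne_one (by norm_num) (mul_right_cancel₀ h2 (by rw [← hy, one_mul]))
  have hFex : ∀ s, ∃ m : T → ℤ, UnitEq α (β (q s)) (M m) := by
    intro s
    have h0 := hq.map_ne_zero hβ s
    obtain ⟨n, hn⟩ := hp.exists_unitEq_mon ha hα h0 (hβa _) (by
      obtain ⟨z, hz⟩ := hq.dvd s
      have h1 := Subring.mul_mem _ (hβa z) hba
      have h2 : β z ≠ 0 := (map_ne_zero_iff β hβ).mpr (right_ne_zero_of_mul (hz ▸ hb))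
      convert h1 using 1
      rw [hz, map_mul]
      field_simp)
    obtain ⟨m, rfl⟩ := hlift' _ n hn (by rw [hgB]; exact UnitEq.refl _ _)
    exact ⟨m, hn⟩
  choose F hF using hFex
  have hFprod : ∀ n : SB → ℤ, UnitEq α (mon β q n) (M fun t => ∑ s, n s * F s t) := by
    intro n
    have h1 : M (fun t => ∑ s, n s * F s t) = ∏ s, M (F s) ^ n s := hp.mon_sum_mul hα _ _
    rw [h1]
    exact UnitEq.prod _ fun s => (hF s).zpow _
  refine lattice_contradiction σQ σT hσQ23 hσT23 w hw hw0 F (fun s t => ?_) (fun n hn => ?_)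
    fun m => ⟨?_, fun hm => ?_⟩
  · obtain ⟨t, rfl⟩ := hπ t
    have h1 := (UnitEq.of_associated (α := β) (hσQ s))
    rw [hσB, ← hU] at h1
    have h2 := hp.mon_injective hα (((hF (σQ s)).symm.trans h1.symm).trans
      (((hF s).map (τD := σD) (τ := σ) hσD).trans (unitEq_map_mon hσD hσS _)))
    have h3 := congrFun h2 (σS t)
    rwa [Equiv.symm_apply_apply] at h3
  · refine hq.mon_injective hβ (m := 0) ((hU _ _).mp ?_)
    have h1 := hFprod n
    simp only [hn] at h1
    convert h1 using 1
    simp [M, mon]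
  · rintro ⟨n, hn⟩
    rw [← hgM']
    have h1 : UnitEq β (M m) (mon β q n) := by
      rw [← hU, show m = _ from funext hn]
      exact (hFprod n).symm
    obtain ⟨c, hc⟩ := h1
    rw [hc, map_mul, hgB]
    simp [mon, map_prod, hgB]
  · rw [← hgM'] at hm
    have h1 : (M m)⁻¹ ∈ awaySubring α a := by
      have h2 := hp.mon_sub hα 0 fun s => m (π s)
      have h3 : mon α p (0 : SA → ℤ) = 1 := by simp [mon]
      rw [h3, one_mul] at h2
      rw [← h2]
      exact hp.mon_mem hα _
    obtain ⟨n, hn⟩ := hq.exists_unitEq_mon hb hβ (hp.mon_ne_zero hα _)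
      (hinv _ hm (hp.mon_mem hα _)) (hinv _ (by rw [map_inv₀, hm]) h1)
    exact ⟨n, congrFun (hMinj _ _ (((hU _ _).mpr hn).trans (hFprod n)))⟩

section Iterate

variable {R : Type*} [CommRing R] {g : R ≃+* R} {n : ℕ}

lemma map_prod_iterate (hg : ∀ x, g^[n] x = x) (x : R) :
    g (∏ i ∈ Finset.range n, g^[i] x) = ∏ i ∈ Finset.range n, g^[i] x := by
  cases n with
  | zero => simp
  | succ n =>
    rw [map_prod, Finset.prod_range_succ, Finset.prod_range_succ', ← Function.iterate_succ_apply' g,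
      hg]
    simp only [Function.iterate_succ_apply', Function.iterate_zero, id_eq]

lemma map_sum_iterate (hg : ∀ x, g^[n] x = x) (x : R) :
    g (∑ i ∈ Finset.range n, g^[i] x) = ∑ i ∈ Finset.range n, g^[i] x := by
  cases n with
  | zero => simp
  | succ n =>
    rw [map_sum, Finset.sum_range_succ, Finset.sum_range_succ', ← Function.iterate_succ_apply' g,
      hg]
    simp only [Function.iterate_succ_apply', Function.iterate_zero, id_eq]

lemma exists_dvd_map_eq_self [IsDomain R] (hn : n ≠ 0) (hg : ∀ x, g^[n] x = x) {x : R}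
    (hx : x ≠ 0) : ∃ y ≠ 0, x ∣ y ∧ g y = y := by
  refine ⟨_, Finset.prod_ne_zero_iff.mpr fun i _ => ?_, ?_, map_prod_iterate hg x⟩
  · have h0 : g^[i] 0 = 0 := Function.iterate_fixed (map_zero g) i
    exact fun h => hx (g.injective.iterate i (h.trans h0.symm))
  · exact Finset.dvd_prod_of_mem (fun i => g^[i] x) (Finset.mem_range.mpr (Nat.pos_of_ne_zero hn))

end Iterate

lemma awaySubring_le_of_dvd {D Ω : Type*} [CommRing D] [Field Ω] (α : D →+* Ω) {d e : D}
    (h : d ∣ e) : awaySubring α d ≤ awaySubring α e := by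
  obtain ⟨c, rfl⟩ := h
  rintro u ⟨k, y, hy⟩
  exact ⟨k, c ^ k * y, by rw [map_mul, map_mul, ← hy, map_pow]; ring⟩

/-- The elements `u` such that `φ(b)^k u` is integral for some `k`. -/
def integralAway {B F : Type*} [CommRing B] [Field F] (φ : B →+* F) (b : B) : Subring F where
  carrier := {u | ∃ k : ℕ, φ.IsIntegralElem (φ b ^ k * u)}
  mul_mem' := by
    rintro u v ⟨k, h⟩ ⟨l, h'⟩
    have h1 : φ b ^ (k + l) * (u * v) = φ b ^ k * u * (φ b ^ l * v) := by ring
    exact ⟨k + l, h1 ▸ h.mul _ h'⟩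
  one_mem' := ⟨0, by simpa using φ.isIntegralElem_one⟩
  add_mem' := by
    rintro u v ⟨k, h⟩ ⟨l, h'⟩
    have h1 : φ b ^ (k + l) * (u + v) = φ (b ^ l) * (φ b ^ k * u) + φ (b ^ k) * (φ b ^ l * v) := by
      rw [map_pow, map_pow]
      ring
    exact ⟨k + l, h1 ▸ (φ.isIntegralElem_map.mul _ h).add _ (φ.isIntegralElem_map.mul _ h')⟩
  zero_mem' := ⟨0, by simpa using φ.isIntegralElem_zero⟩
  neg_mem' := by
    rintro u ⟨k, h⟩
    exact ⟨k, by simpa using h⟩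

/-- An integrally closed domain contains the elements of its localization at `b` that are
integral up to powers of `b`. -/
lemma mem_awaySubring_of_mem_integralAway {B Ω : Type*} [CommRing B] [IsDomain B]
    [IsIntegrallyClosed B] [Field Ω] {β : B →+* Ω} (hβ : Function.Injective β) {b : B} {u : Ω}
    (hu : u ∈ integralAway β b) (hu' : ∃ r s, s ≠ 0 ∧ u * β s = β r) : u ∈ awaySubring β b := by
  obtain ⟨k, hk⟩ := hu
  obtain ⟨r, s, hs, h⟩ := hu'
  let γ : FractionRing B →+* Ω := IsFractionRing.lift hβ
  have hγ : γ.comp (algebraMap B (FractionRing B)) = β :=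
    RingHom.ext fun x => IsFractionRing.lift_algebraMap hβ x
  have hγ' : ∀ x, γ (algebraMap B (FractionRing B) x) = β x := IsFractionRing.lift_algebraMap hβ
  have h1 : β b ^ k * u = γ (algebraMap B _ (b ^ k * r) / algebraMap B _ s) := by
    have h0 : β s ≠ 0 := (map_ne_zero_iff β hβ).mpr hs
    rw [map_div₀, hγ', hγ', map_mul, ← h, map_pow]
    field_simp
  rw [h1, ← hγ] at hk
  obtain ⟨y, hy⟩ := IsIntegrallyClosed.isIntegral_iff.mp (hk.of_map γ.injective)
  exact ⟨k, y, by rw [h1, ← hy, hγ']⟩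

/-- Common denominators for the comparison of `A` with a ring `B` whose fraction field is the field
of invariants. -/
theorem exists_common_denominators {A F B I J : Type*} [CommRing A] [IsDomain A] [Field F]
    [Algebra A F] [IsFractionRing A F] [CommRing B] [IsDomain B] [Finite I] [Finite J]
    {gA : A ≃+* A} {gF : F ≃+* F} (hgF : ∀ x, gF (algebraMap A F x) = algebraMap A F (gA x))
    (hgA : ∀ x, gA^[47] x = x) {φ : B →+* F} (hφ : Function.Injective φ)
    (hgφ : ∀ x, gF (φ x) = φ x) (hfix : ∀ f, gF f = f → ∃ r s, s ≠ 0 ∧ f * φ s = φ r)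
    (hint : ∀ x : A, ∃ b ≠ 0, φ.IsIntegralElem (φ b * algebraMap A F x)) (x : I → A) (z : J → B)
    (hgen : ∀ S : Subring F, (∀ j, φ (z j) ∈ S) → (∀ y : A, algebraMap A F y ∈ S) → ∀ b, φ b ∈ S)
    {y : A} (hy0 : y ≠ 0) (hy : gA y = y) :
    ∃ (a : A) (b : B), a ≠ 0 ∧ b ≠ 0 ∧ gA a = a ∧ y ∣ a ∧
      (∀ j, φ (z j) ∈ awaySubring (algebraMap A F) a) ∧ (φ b)⁻¹ ∈ awaySubring (algebraMap A F) a ∧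
      (∀ i, algebraMap A F (x i) ∈ integralAway φ b) ∧
      (algebraMap A F a)⁻¹ ∈ integralAway φ b := by
  classical
  have := Fintype.ofFinite I
  have := Fintype.ofFinite J
  let α : A →+* F := algebraMap A F
  have hα : Function.Injective α := IsFractionRing.injective A F
  choose c hc0 hc using fun i => hint (x i)
  have hz : ∀ j, ∃ p q : A, q ≠ 0 ∧ φ (z j) = α p / α q := fun j => by
    obtain ⟨p, q, hq, h⟩ := IsFractionRing.div_surjective (A := A) (φ (z j))
    exact ⟨p, q, nonZeroDivisors.ne_zero hq, h.symm⟩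
  choose p q hq0 hpq using hz
  obtain ⟨q', hq', hqq, hgq⟩ := exists_dvd_map_eq_self (by norm_num) hgA
    (Finset.prod_ne_zero_iff.mpr fun j (_ : j ∈ Finset.univ) => hq0 j)
  let a₁ := y * q'
  have ha₁ : a₁ ≠ 0 := mul_ne_zero hy0 hq'
  have hga₁ : gA a₁ = a₁ := by rw [map_mul, hy, hgq]
  have hz' : ∀ j, φ (z j) ∈ awaySubring α a₁ := fun j => by
    refine awaySubring_le_of_dvd α
      ((Finset.dvd_prod_of_mem q (Finset.mem_univ j)).trans (hqq.trans (dvd_mul_left _ _))) ?_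
    refine ⟨1, p j, ?_⟩
    have := (map_ne_zero_iff α hα).mpr (hq0 j)
    rw [hpq]
    field_simp
  obtain ⟨b₂, b₃, hb₃, hb⟩ := hfix (α a₁) (by rw [hgF, hga₁])
  have hφa₁ := (map_ne_zero_iff α hα).mpr ha₁
  have hφb₃ := (map_ne_zero_iff φ hφ).mpr hb₃
  have hb₂ : b₂ ≠ 0 := by
    rintro rfl
    rw [map_zero] at hb
    exact mul_ne_zero hφa₁ hφb₃ hb
  let b₁ := ∏ i, c i
  have hb₁ : b₁ ≠ 0 := Finset.prod_ne_zero_iff.mpr fun i _ => hc0 i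
  let b := b₁ * b₂ * b₃
  have hb0 : b ≠ 0 := mul_ne_zero (mul_ne_zero hb₁ hb₂) hb₃
  have hφb := (map_ne_zero_iff φ hφ).mpr hb0
  obtain ⟨k, m, hm⟩ : φ b ∈ awaySubring α a₁ := hgen _ hz' (map_mem_awaySubring α a₁) b
  have hm0 : m ≠ 0 := by
    rintro rfl
    rw [map_zero] at hm
    exact mul_ne_zero (pow_ne_zero k hφa₁) hφb hm
  have hαm := (map_ne_zero_iff α hα).mpr hm0
  have hgm : gA m = m := by
    apply hα
    rw [← hgF, ← hm, map_mul, map_pow, hgF, hga₁, hgφ]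
  refine ⟨a₁ * m, b, mul_ne_zero ha₁ hm0, hb0, by rw [map_mul, hga₁, hgm],
    (dvd_mul_right _ _).trans (dvd_mul_right _ _),
    fun j => awaySubring_le_of_dvd α (dvd_mul_right _ _) (hz' j), ⟨1, a₁ ^ (k + 1), ?_⟩,
    fun i => ?_,
    ?_⟩
  · have h1 : α (a₁ * m) ^ 1 * (φ b)⁻¹ = α (a₁ ^ (k + 1)) := by
      rw [map_mul, ← hm, map_pow α, pow_one, pow_succ]
      field_simp
    exact h1
  · obtain ⟨d, hd⟩ : c i ∣ b := (Finset.dvd_prod_of_mem c (Finset.mem_univ i)).trans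
      ((dvd_mul_right _ _).trans (dvd_mul_right _ _))
    have h1 : φ b ^ 1 * α (x i) = φ d * (φ (c i) * α (x i)) := by rw [hd, map_mul]; ring
    exact ⟨1, h1 ▸ φ.isIntegralElem_map.mul _ (hc i)⟩
  · have h1 : φ b ^ (k + 2) * (α (a₁ * m))⁻¹ = φ ((b₁ * b₃ ^ 2) ^ (k + 1)) := by
      have h2 : φ (b₁ * b₃ ^ 2) * α a₁ = φ b := by
        simp only [b, map_mul, map_pow, ← hb]
        ring
      rw [map_mul α, ← hm, map_pow φ, eq_div_of_mul_eq hφa₁ h2, div_pow]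
      field_simp
      ring
    exact ⟨k + 2, h1 ▸ φ.isIntegralElem_map⟩

namespace MvPolynomial

lemma rename_iterate {R ι : Type*} [CommRing R] (e : ι → ι) (k : ℕ) (p : MvPolynomial ι R) :
    (rename e)^[k] p = rename e^[k] p := by
  induction k generalizing p with
  | zero => simp
  | succ k ih => rw [Function.iterate_succ_apply, ih, rename_rename, ← Function.iterate_succ]

lemma coeff_map_iterate {R ι : Type*} [CommRing R] (τ : R →+* R) (k : ℕ) (p : MvPolynomial ι R)
    (m : ι →₀ ℕ) : coeff m ((map τ)^[k] p) = τ^[k] (coeff m p) := by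
  induction k generalizing p with
  | zero => simp
  | succ k ih => rw [Function.iterate_succ_apply, ih, coeff_map, ← Function.iterate_succ_apply]

lemma rename_mulLeft_iterate {R : Type*} [CommRing R] (g : Multiplicative (ZMod 47))
    (p : MvPolynomial (Multiplicative (ZMod 47)) R) : (rename (g * ·))^[47] p = p := by
  have h : g ^ 47 = 1 := by
    rw [← ofAdd_toAdd g, ← ofAdd_nsmul, nsmul_eq_mul, CharP.cast_eq_zero (ZMod 47) 47, zero_mul,
      ofAdd_zero]
  rw [rename_iterate, mul_left_iterate, h]
  simp only [one_mul]
  exact rename_id_apply p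

lemma map_iterate_eq_self {R ι : Type*} [CommRing R] {τ : R →+* R} {k : ℕ}
    (h : ∀ x, τ^[k] x = x) (p : MvPolynomial ι R) : (map τ)^[k] p = p := by
  ext m
  rw [coeff_map_iterate, h]

lemma unitEq_iff {L ι Ω : Type*} [Field L] [Field Ω] (α : MvPolynomial ι L →+* Ω) (u v : Ω) :
    UnitEq α u v ↔ ∃ c : Lˣ, u = α (C (c : L)) * v := by
  constructor
  · rintro ⟨c, hc⟩
    have h := (isUnit_iff_eq_C_of_isReduced (P := (c : MvPolynomial ι L))).mp c.isUnit
    obtain ⟨r, hr, h⟩ := h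
    exact ⟨hr.unit, by rw [hc, h]; rfl⟩
  · rintro ⟨c, rfl⟩
    exact ⟨Units.map (C : L →+* MvPolynomial ι L).toMonoidHom c, rfl⟩

end MvPolynomial

/-- The field of fractions of the image of an injective homomorphism to a field. -/
lemma mem_fieldRange_lift_iff {B Ω : Type*} [CommRing B] [IsDomain B] [Field Ω] {β : B →+* Ω}
    (hβ : Function.Injective β) {u : Ω} :
    u ∈ (IsFractionRing.lift hβ : FractionRing B →+* Ω).fieldRange ↔
      ∃ r s, s ≠ 0 ∧ u * β s = β r := by
  constructor
  · rintro ⟨f, rfl⟩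
    obtain ⟨r, s, hs, rfl⟩ := IsFractionRing.div_surjective (A := B) f
    have hs := nonZeroDivisors.ne_zero hs
    have := (map_ne_zero_iff β hβ).mpr hs
    refine ⟨r, s, hs, ?_⟩
    rw [map_div₀, IsFractionRing.lift_algebraMap, IsFractionRing.lift_algebraMap]
    field_simp
  · rintro ⟨r, s, hs, h⟩
    refine ⟨algebraMap _ _ r / algebraMap _ _ s, ?_⟩
    rw [map_div₀, IsFractionRing.lift_algebraMap, IsFractionRing.lift_algebraMap, ← h]
    have := (map_ne_zero_iff β hβ).mpr hs
    field_simp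

theorem false_of_fixed_field_rational {L : Type} [Field L] [Algebra ℚ L] [Algebra.IsAlgebraic ℚ L]
    {ζ : L} (hζ : IsPrimitiveRoot ζ 47) {τ : L ≃+* L} (hτζ : τ ζ = ζ ^ 2)
    (hτ : ∀ x, τ^[23] x = x)
    (gF : FractionRing (MvPolynomial (Multiplicative (ZMod 47)) ℚ) ≃+*
      FractionRing (MvPolynomial (Multiplicative (ZMod 47)) ℚ))
    (hgF : ∀ p : MvPolynomial (Multiplicative (ZMod 47)) ℚ, gF (algebraMap _ _ p) =
      algebraMap _ _ (rename (Multiplicative.ofAdd (-1) * ·) p)) {n : ℕ}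
    {φ : MvPolynomial (Fin n) ℚ →+* FractionRing (MvPolynomial (Multiplicative (ZMod 47)) ℚ)}
    (hφ : Function.Injective φ) (hgφ : ∀ p, gF (φ p) = φ p)
    (hfix : ∀ f, gF f = f → ∃ r s, s ≠ 0 ∧ f * φ s = φ r)
    (hint : ∀ p : MvPolynomial (Multiplicative (ZMod 47)) ℚ,
      ∃ b ≠ 0, φ.IsIntegralElem (φ b * algebraMap _ _ p)) : False := by
  let G := Multiplicative (ZMod 47)
  let A := MvPolynomial G ℚ
  let F := FractionRing A
  let D := MvPolynomial G L
  let Ω := FractionRing D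
  let g₀ : G := Multiplicative.ofAdd (-1)
  let gA : A ≃+* A := (renameEquiv ℚ (Equiv.mulLeft g₀)).toRingEquiv
  let gD : D ≃+* D := (renameEquiv L (Equiv.mulLeft g₀)).toRingEquiv
  let σD : D ≃+* D := mapEquiv G τ
  let σB : MvPolynomial (Fin n) L ≃+* MvPolynomial (Fin n) L := mapEquiv (Fin n) τ
  let α : D →+* Ω := algebraMap D Ω
  have hα : Function.Injective α := IsFractionRing.injective D Ω
  let g : Ω ≃+* Ω := IsFractionRing.ringEquivOfRingEquiv gD
  let σ : Ω ≃+* Ω := IsFractionRing.ringEquivOfRingEquiv σD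
  have hgD : ∀ x, α (gD x) = g (α x) :=
    fun x => (IsFractionRing.ringEquivOfRingEquiv_algebraMap gD x).symm
  have hσD : ∀ x, α (σD x) = σ (α x) :=
    fun x => (IsFractionRing.ringEquivOfRingEquiv_algebraMap σD x).symm
  have hgA47 : ∀ x, gA^[47] x = x := rename_mulLeft_iterate g₀
  have hgD47 : ∀ x, gD^[47] x = x := rename_mulLeft_iterate g₀
  let j : A →+* D := MvPolynomial.map (algebraMap ℚ L)
  have hj : Function.Injective j := map_injective _ (algebraMap ℚ L).injective
  have hgj : ∀ x, gD (j x) = j (gA x) := fun x => (map_rename _ _ x).symm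
  have hττ : τ.toRingHom.comp (algebraMap ℚ L) = algebraMap ℚ L := Subsingleton.elim _ _
  have hσj : ∀ x, σD (j x) = j x := fun x => by
    have h := map_map (algebraMap ℚ L) τ.toRingHom x
    rw [hττ] at h
    exact h
  have hgC : ∀ c, gD (C c) = C c := fun c => rename_C _ c
  have hσC : ∀ c, σD (C c) = C (τ c) := fun c => map_C _ c
  let ι : F →+* Ω := IsFractionRing.lift (A := A) (g := α.comp j) (hα.comp hj)
  have hι : ∀ x, ι (algebraMap A F x) = α (j x) := IsFractionRing.lift_algebraMap _
  have hgι : ∀ f, g (ι f) = ι (gF f) := fun f => by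
    have h : g.toRingHom.comp ι = ι.comp gF.toRingHom := by
      refine IsFractionRing.ringHom_ext (A := A) fun x => ?_
      have h1 : g (ι (algebraMap A F x)) = ι (gF (algebraMap A F x)) := by
        rw [hι, ← hgD, hgj, ← hι]
        exact congrArg ι (hgF x).symm
      exact h1
    exact RingHom.congr_fun h f
  have hσι : ∀ f, σ (ι f) = ι f := fun f => by
    have h : σ.toRingHom.comp ι = ι := by
      refine IsFractionRing.ringHom_ext (A := A) fun x => ?_
      have h1 : σ (ι (algebraMap A F x)) = ι (algebraMap A F x) := by
        rw [hι, ← hσD, hσj]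
      exact h1
    exact RingHom.congr_fun h f
  let β : MvPolynomial (Fin n) L →+* Ω := eval₂Hom (α.comp C) fun i => ι (φ (X i))
  have hβC : ∀ c, β (C c) = α (C c) := fun c => eval₂Hom_C _ _ c
  have hβX : ∀ i, β (X i) = ι (φ (X i)) := fun i => eval₂Hom_X' _ _ i
  have hβcomp : β.comp (MvPolynomial.map (algebraMap ℚ L)) = ι.comp φ := by
    refine MvPolynomial.ringHom_ext (fun c => ?_) fun i => ?_
    · exact RingHom.congr_fun (Subsingleton.elim
        ((β.comp (MvPolynomial.map (algebraMap ℚ L))).comp C) ((ι.comp φ).comp C)) c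
    · rw [RingHom.comp_apply, map_X, hβX]
      rfl
  have hβmap : ∀ p, β (MvPolynomial.map (algebraMap ℚ L) p) = ι (φ p) :=
    RingHom.congr_fun hβcomp
  have hβ : Function.Injective β := by
    have h1 : AlgebraicIndependent ℚ fun i => ι (φ (X i)) := by
      rw [algebraicIndependent_iff_injective_aeval]
      have h2 : ((aeval fun i => ι (φ (X i)) : MvPolynomial (Fin n) ℚ →ₐ[ℚ] Ω) :
          MvPolynomial (Fin n) ℚ →+* Ω) = ι.comp φ := by
        refine MvPolynomial.ringHom_ext (fun c => ?_) fun i => ?_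
        · exact RingHom.congr_fun (Subsingleton.elim (RingHom.comp _ C) ((ι.comp φ).comp C)) c
        · simp
      intro p q hpq
      have h3 : ι (φ p) = ι (φ q) :=
        (RingHom.congr_fun h2 p).symm.trans (hpq.trans (RingHom.congr_fun h2 q))
      exact hφ (ι.injective h3)
    exact (h1.extendScalars L : AlgebraicIndependent L _)
  have hgα : ∀ c, g (α (C c)) = α (C c) := fun c => by rw [← hgD, hgC]
  have hgB : ∀ x, g (β x) = β x := by
    have h : g.toRingHom.comp β = β := by
      refine MvPolynomial.ringHom_ext (fun c => ?_) fun i => ?_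
      · have h1 : g (β (C c)) = β (C c) := by rw [hβC, hgα]
        exact h1
      · have h1 : g (β (X i)) = β (X i) := by rw [hβX, hgι, hgφ]
        exact h1
    exact RingHom.congr_fun h
  have hσB : ∀ x, β (σB x) = σ (β x) := by
    have h : β.comp σB.toRingHom = σ.toRingHom.comp β := by
      refine MvPolynomial.ringHom_ext (fun c => ?_) fun i => ?_
      · have h1 : β (σB (C c)) = σ (β (C c)) := by
          rw [hβC, ← hσD, hσC, ← hβC]
          exact congrArg β (map_C _ c)
        exact h1
      · have h1 : β (σB (X i)) = σ (β (X i)) := by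
          rw [hβX, hσι, ← hβX]
          exact congrArg β (map_X _ i)
        exact h1
    exact RingHom.congr_fun h
  have hU : ∀ u v, UnitEq α u v ↔ UnitEq β u v := fun u v => by
    rw [MvPolynomial.unitEq_iff, MvPolynomial.unitEq_iff]
    simp only [hβC]
  have hV : ∀ u, g u = u → ∃ r s, s ≠ 0 ∧ u * β s = β r := fun u hu => by
    let V : Subfield Ω :=
      (IsFractionRing.lift hβ : FractionRing (MvPolynomial (Fin n) L) →+* Ω).fieldRange
    have hV : ∀ {u}, u ∈ V ↔ ∃ r s, s ≠ 0 ∧ u * β s = β r := mem_fieldRange_lift_iff hβ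
    have hβV : ∀ x, β x ∈ V := fun x => hV.mpr ⟨x, 1, one_ne_zero, by rw [map_one, mul_one]⟩
    have hιV : ∀ f, gF f = f → ι f ∈ V := fun f hf => by
      obtain ⟨r, s, hs, h⟩ := hfix f hf
      refine hV.mpr ⟨MvPolynomial.map (algebraMap ℚ L) r, MvPolynomial.map (algebraMap ℚ L) s,
        (map_ne_zero_iff _ (map_injective _ (algebraMap ℚ L).injective)).mpr hs, ?_⟩
      rw [hβmap, hβmap, ← h, map_mul]
    have hsum : ∀ p : D, α (∑ i ∈ Finset.range 47, gD^[i] p) ∈ V := fun p => by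
      induction p using MvPolynomial.induction_on' with
      | add p q hp hq =>
        have h1 : α (∑ i ∈ Finset.range 47, gD^[i] (p + q)) =
            α (∑ i ∈ Finset.range 47, gD^[i] p) + α (∑ i ∈ Finset.range 47, gD^[i] q) := by
          rw [← map_add, ← Finset.sum_add_distrib]
          simp only [iterate_map_add]
        rw [h1]
        exact V.add_mem hp hq
      | monomial m c =>
        have h1 : ∀ i, gD^[i] (monomial m c) = C c * j (gA^[i] (monomial m 1)) := fun i => by
          induction i with
          | zero =>
            have h2 : j (monomial m 1) = monomial m 1 := by
              rw [← map_one (algebraMap ℚ L)]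
              exact map_monomial _ m 1
            rw [Function.iterate_zero, id_eq, Function.iterate_zero, id_eq, h2, C_mul_monomial,
              mul_one]
          | succ i ih =>
            rw [Function.iterate_succ_apply', ih, map_mul, hgC, hgj, Function.iterate_succ_apply']
        simp only [h1]
        rw [← Finset.mul_sum, ← map_sum, map_mul, ← hβC, ← hι]
        refine V.mul_mem (hβV _) (hιV _ ?_)
        refine (hgF _).trans (congrArg (algebraMap A F) ?_)
        exact map_sum_iterate hgA47 _
    obtain ⟨P, Q, hQ, hPQ⟩ := IsFractionRing.div_surjective (A := D) u
    have hQ := nonZeroDivisors.ne_zero hQ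
    obtain ⟨q, hq, hQq⟩ := MvPolynomial.exists_dvd_map_of_isAlgebraic (R := ℚ) hQ
    obtain ⟨q', hq', hqq', hgq'⟩ := exists_dvd_map_eq_self (by norm_num) hgA47 hq
    obtain ⟨c, hc⟩ : Q ∣ j q' := hQq.trans (map_dvd j hqq')
    have hαQ := (map_ne_zero_iff α hα).mpr hQ
    have hjq : α (j q') ≠ 0 := (map_ne_zero_iff α hα).mpr ((map_ne_zero_iff j hj).mpr hq')
    have huq : u * α (j q') = α (P * c) := by
      have h1 : u = α P / α Q := hPQ.symm
      rw [h1, hc, map_mul, map_mul, ← mul_assoc, div_mul_cancel₀ _ hαQ]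
    have hgP : gD (P * c) = P * c := by
      apply hα
      rw [hgD, ← huq, map_mul, hu, ← hgD, hgj, hgq']
    have h47 : α (P * c) ∈ V := by
      have h1 := hsum (P * c)
      simp only [Function.iterate_fixed hgP, Finset.sum_const, Finset.card_range, nsmul_eq_mul,
        map_mul α, map_natCast] at h1
      have h2 := V.mul_mem (V.inv_mem (natCast_mem V 47)) h1
      have h3 : ((47 : ℕ) : Ω) ≠ 0 := by
        rw [← map_natCast (algebraMap ℚ Ω) 47]
        exact (map_ne_zero _).mpr (by norm_num)
      rw [map_mul]
      rwa [inv_mul_cancel_left₀ h3] at h2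
    refine hV.mp ?_
    rw [eq_div_of_mul_eq hjq huq]
    refine V.div_mem h47 ?_
    rw [← hι]
    exact hιV _ ((hgF _).trans (congrArg (algebraMap A F) hgq'))
  let ζ' : Dˣ := Units.map (C : L →+* D).toMonoidHom (hζ.isUnit (by norm_num)).unit
  have hζ' : α ζ' = α (C ζ) := rfl
  have hζα : IsPrimitiveRoot (α ζ') 47 :=
    hζ.map_of_injective (f := α.comp C) (hα.comp (C_injective G L))
  let y : D := ∑ h : G, C (ζ ^ (Multiplicative.toAdd h).val) * X h
  have hgy : gD y = C ζ * y := by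
    have h1 : ∀ h : G, gD (X h) = X (g₀ * h) := fun h => rename_X _ h
    simp only [y, map_sum, map_mul, hgC, h1, Finset.mul_sum]
    rw [← Equiv.sum_comp (Equiv.mulLeft g₀)
      fun h : G => C ζ * (C (ζ ^ (Multiplicative.toAdd h).val) * X h)]
    refine Finset.sum_congr rfl fun h _ => ?_
    rw [← mul_assoc, ← C_mul, Equiv.coe_mulLeft, ← pow_succ']
    congr 2
    refine pow_eq_pow_of_modEq ?_ hζ.pow_eq_one
    rw [← ZMod.natCast_eq_natCast_iff]
    simp only [ZMod.natCast_val, ZMod.cast_id, Nat.cast_add, Nat.cast_one]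
    have h1 : ∀ z : ZMod 47, z = -1 + z + 1 := fun z => by ring
    exact h1 _
  have hy0 : y ≠ 0 := by
    intro h
    have h1 : eval (Pi.single (1 : G) (1 : L)) y = 1 := by
      rw [map_sum, Finset.sum_eq_single 1]
      · simp
      · intro h _ hh
        simp [hh]
      · simp
    rw [h, map_zero] at h1
    exact zero_ne_one h1
  obtain ⟨y₁, hy₁, hyy₁⟩ := MvPolynomial.exists_dvd_map_of_isAlgebraic (R := ℚ) hy0
  obtain ⟨y₂, hy₂, hyy₂, hgy₂⟩ := exists_dvd_map_eq_self (by norm_num) hgA47 hy₁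
  obtain ⟨a, b, ha, hb, hga, hya, hza, hba, hxb, hab⟩ := exists_common_denominators
    (A := A) (F := F) hgF hgA47 hφ hgφ hfix hint (X : G → A) (X : Fin n → MvPolynomial (Fin n) ℚ)
    (fun S hX hA p => by
      induction p using MvPolynomial.induction_on with
      | C c =>
        have h1 := RingHom.congr_fun
          (Subsingleton.elim (φ.comp C) ((algebraMap A F).comp C)) c
        exact (congrArg (· ∈ S) h1).mpr (hA _)
      | add p q hp hq => exact map_add φ p q ▸ S.add_mem hp hq
      | mul_X p i hp => exact map_mul φ p _ ▸ S.mul_mem hp (hX i)) hy₂ hgy₂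
  have hιaway : ∀ f, f ∈ awaySubring (algebraMap A F) a → ι f ∈ awaySubring α (j a) := by
    rintro f ⟨k, x, h⟩
    exact ⟨k, j x, by rw [← hι, ← hι, ← h, map_mul, map_pow]⟩
  have hιint : ∀ f, f ∈ integralAway φ b →
      ι f ∈ integralAway β (MvPolynomial.map (algebraMap ℚ L) b) := by
    rintro f ⟨k, h⟩
    refine ⟨k, RingHom.IsIntegralElem.of_comp (f := MvPolynomial.map (algebraMap ℚ L)) ?_⟩
    rw [hβcomp, hβmap, ← map_pow, ← map_mul]
    exact h.map ι
  refine false_of_awaySubring_invariants hα hβ hgD hσD hσB hgB hgD47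
    (map_iterate_eq_self hτ) (map_iterate_eq_self hτ) ?_ hU (a := j a)
    (b := MvPolynomial.map (algebraMap ℚ L) b) ((map_ne_zero_iff j hj).mpr ha)
    ((map_ne_zero_iff _ (map_injective _ (algebraMap ℚ L).injective)).mpr hb)
    (by rw [hgj, hga]) (hσj a) ?_ ?_ ?_ ?_ (ζ := ζ') hζα
    ?_ (hyy₁.trans (map_dvd j (hyy₂.trans hya))) (by rw [← hgD, hgy, map_mul, hζ'])
  · intro x
    have h : gD.toRingHom.comp σD.toRingHom = σD.toRingHom.comp gD.toRingHom := by
      refine MvPolynomial.ringHom_ext (fun c => ?_) fun i => ?_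
      · have h1 : gD (σD (C c)) = σD (gD (C c)) := by rw [hσC, hgC, hgC, hσC]
        exact h1
      · have h1 : gD (σD (X i)) = σD (gD (X i)) := by
          rw [show σD (X i) = X i from map_X _ i, show gD (X i) = X (g₀ * i) from rename_X _ i]
          exact (map_X _ (g₀ * i)).symm
        exact h1
    exact RingHom.congr_fun h x
  · exact (map_map _ _ b).trans (congrArg (fun f => MvPolynomial.map f b) hττ)
  · intro x
    induction x using MvPolynomial.induction_on with
    | C c => exact hβC c ▸ map_mem_awaySubring _ _ _
    | add p q hp hq => exact map_add β p q ▸ Subring.add_mem _ hp hq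
    | mul_X p i hp =>
      rw [map_mul, hβX]
      exact Subring.mul_mem _ hp (hιaway _ (hza i))
  · rw [hβmap, ← map_inv₀]
    exact hιaway _ hba
  · intro u hu hua
    refine mem_awaySubring_of_mem_integralAway hβ ?_ (hV u hu)
    obtain ⟨k, x, h⟩ := hua
    have h1 : u = (ι (algebraMap A F a)⁻¹) ^ k * α x := by
      have h2 : α (j a) ≠ 0 := (map_ne_zero_iff α hα).mpr ((map_ne_zero_iff j hj).mpr ha)
      rw [← h, map_inv₀, hι, ← mul_assoc, ← mul_pow, inv_mul_cancel₀ h2, one_pow, one_mul]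
    rw [h1]
    clear h h1
    refine Subring.mul_mem _ (Subring.pow_mem _ (hιint _ hab) k) ?_
    induction x using MvPolynomial.induction_on with
    | C c =>
      refine ⟨0, ?_⟩
      rw [pow_zero, one_mul, ← hβC]
      exact β.isIntegralElem_map
    | add p q hp hq => exact map_add α p q ▸ Subring.add_mem _ hp hq
    | mul_X p i hp =>
      rw [map_mul, show α (X i) = ι (algebraMap A F (X i)) by
        rw [hι, show j (X i) = X i from map_X _ i]]
      exact Subring.mul_mem _ hp (hιint _ (hxb i))
  · rw [hζ', ← hσD, hσC, hτζ, C_pow, map_pow]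

lemma exists_aut_zeta_sq : ∃ (L : Type) (_ : Field L) (_ : Algebra ℚ L)
    (_ : Algebra.IsAlgebraic ℚ L) (ζ : L) (τ : L ≃+* L),
    IsPrimitiveRoot ζ 47 ∧ τ ζ = ζ ^ 2 ∧ ∀ x, τ^[23] x = x := by
  have : IsCyclotomicExtension {47} ℚ (CyclotomicField 47 ℚ) := by
    convert CyclotomicField.isCyclotomicExtension 47 ℚ
    · rfl
    · exact Subsingleton.elim _ _
  have hζ := IsCyclotomicExtension.zeta_spec 47 ℚ (CyclotomicField 47 ℚ)
  have h23 : (2 : ZMod 47) ^ 23 = 1 := by decide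
  let u : (ZMod 47)ˣ := Units.ofPowEqOne 2 23 h23 (by norm_num)
  let e := IsCyclotomicExtension.Rat.galEquivZMod 47 (CyclotomicField 47 ℚ)
  let τ : Gal(CyclotomicField 47 ℚ/ℚ) := e.symm u
  have hu : u ^ 23 = 1 := Units.ext h23
  have hτ : τ ^ 23 = 1 := by rw [← map_pow, hu, map_one]
  refine ⟨CyclotomicField 47 ℚ, inferInstance, inferInstance, ?_, _, τ.toRingEquiv, hζ, ?_, ?_⟩
  · have := IsCyclotomicExtension.finiteDimensional {47} ℚ (CyclotomicField 47 ℚ)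
    exact Algebra.IsAlgebraic.of_finite ℚ (CyclotomicField 47 ℚ)
  · have h := IsCyclotomicExtension.Rat.galEquivZMod_apply_of_pow_eq 47 (CyclotomicField 47 ℚ) τ
      hζ.pow_eq_one
    rw [show IsCyclotomicExtension.Rat.galEquivZMod 47 (CyclotomicField 47 ℚ) τ = u from
      e.apply_symm_apply u] at h
    exact h
  · intro x
    have h : ∀ k, τ.toRingEquiv^[k] x = (τ ^ k) x := fun k => by
      induction k with
      | zero => rfl
      | succ k ih => rw [Function.iterate_succ_apply', ih, pow_succ']; rfl
    rw [h, hτ]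
    rfl

lemma IsRational.exists_ringEquiv {k K : Type*} [Field k] [Field K] [Algebra k K]
    (h : IsRational k K) : ∃ n : ℕ, Nonempty (K ≃+* FractionRing (MvPolynomial (Fin n) k)) :=
  h.imp fun _ ⟨θ⟩ => ⟨θ.toRingEquiv⟩

/-- **Swan's theorem.** Let `C₄₇` be the cyclic group of order 47, acting on the rational
function field `ℚ(x_g : g ∈ C₄₇)` by the regular permutation action `h · x_g = x_{hg}`.
Then the Noether invariant field `ℚ(C₄₇) = ℚ(x_g : g ∈ C₄₇)^{C₄₇}` is not `ℚ`-rational. -/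
theorem swan_noether_C47_not_rational
    (ρ : Multiplicative (ZMod 47) →*
      (FractionRing (MvPolynomial (Multiplicative (ZMod 47)) ℚ) ≃ₐ[ℚ]
        FractionRing (MvPolynomial (Multiplicative (ZMod 47)) ℚ)))
    (hperm : ∀ g h : Multiplicative (ZMod 47),
      ρ g (algebraMap (MvPolynomial (Multiplicative (ZMod 47)) ℚ) _ (X h)) =
        algebraMap (MvPolynomial (Multiplicative (ZMod 47)) ℚ) _ (X (g * h))) :
    ¬ IsRational ℚ (IntermediateField.fixedField ρ.range) := by
  intro hrat
  obtain ⟨n, ⟨θ⟩⟩ := hrat.exists_ringEquiv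
  let A := MvPolynomial (Multiplicative (ZMod 47)) ℚ
  let F := FractionRing A
  let B := MvPolynomial (Fin n) ℚ
  let E := IntermediateField.fixedField ρ.range
  obtain ⟨L, _, _, _, ζ, τ, hζ, hτζ, hτ⟩ := exists_aut_zeta_sq
  let g₀ : Multiplicative (ZMod 47) := Multiplicative.ofAdd (-1)
  let ψ : B →+* E := (θ.symm : FractionRing B →+* E).comp (algebraMap B (FractionRing B))
  have hψ : Function.Injective ψ := θ.symm.injective.comp (IsFractionRing.injective B _)
  let φ : B →+* F := (algebraMap E F).comp ψ
  have hφ : Function.Injective φ := (algebraMap E F).injective.comp hψ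
  let gF : F ≃+* F := (ρ g₀).toRingEquiv
  refine false_of_fixed_field_rational hζ hτζ hτ gF (fun p => ?_) hφ (fun p => ?_)
    (fun f hf => ?_) fun p => ?_
  · have h : gF.toRingHom.comp (algebraMap A F) =
        (algebraMap A F).comp (rename (g₀ * ·) : A →ₐ[ℚ] A).toRingHom := by
      refine MvPolynomial.ringHom_ext (fun c => ?_) fun i => ?_
      · exact RingHom.congr_fun (Subsingleton.elim ((gF.toRingHom.comp (algebraMap A F)).comp C)
          (((algebraMap A F).comp (rename (g₀ * ·) : A →ₐ[ℚ] A).toRingHom).comp C)) c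
      · exact (hperm g₀ i).trans (congrArg (algebraMap A F) (rename_X _ i).symm)
    exact RingHom.congr_fun h p
  · exact (ψ p).2 ⟨_, g₀, rfl⟩
  · have hfE : f ∈ E := by
      rintro ⟨_, g, rfl⟩
      have h : ∀ k : ℕ, ρ (g₀ ^ k) f = f := fun k => by
        induction k with
        | zero => rw [pow_zero, map_one]; rfl
        | succ k ih => rw [pow_succ, map_mul]; exact (congrArg (ρ (g₀ ^ k)) hf).trans ih
      have hg : g₀ ^ (Multiplicative.toAdd g⁻¹).val = g := by
        apply Multiplicative.toAdd.injective
        rw [toAdd_pow, nsmul_eq_mul, ZMod.natCast_val, ZMod.cast_id]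
        simp [g₀]
      exact hg ▸ h _
    obtain ⟨r, s, hs, h⟩ := IsFractionRing.div_surjective (A := B) (θ ⟨f, hfE⟩)
    refine ⟨r, s, nonZeroDivisors.ne_zero hs, ?_⟩
    have hs0 : algebraMap B (FractionRing B) s ≠ 0 :=
      IsFractionRing.to_map_ne_zero_of_mem_nonZeroDivisors hs
    have h1 : (⟨f, hfE⟩ : E) * ψ s = ψ r := by
      apply θ.injective
      rw [map_mul, ← h]
      exact (congrArg (_ * ·) (θ.apply_symm_apply _)).trans
        ((div_mul_cancel₀ _ hs0).trans (θ.apply_symm_apply _).symm)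
    exact congrArg (algebraMap E F) h1
  · have : Finite ρ.range := Set.finite_range ρ
    let _ : Algebra B E := ψ.toAlgebra
    let _ : Algebra B F := φ.toAlgebra
    have : IsScalarTower B E F := IsScalarTower.of_algebraMap_eq fun _ => rfl
    have : IsFractionRing B E := IsLocalization.isLocalization_of_algEquiv (nonZeroDivisors B)
      (AlgEquiv.ofRingEquiv (f := θ.symm) fun _ => rfl : FractionRing B ≃ₐ[B] E)
    have : IsAlgebraic E (algebraMap _ F p) :=
      (FixedPoints.isIntegral ρ.range F (algebraMap _ F p)).isAlgebraic
    obtain ⟨b, hb, h⟩ := ((IsFractionRing.isAlgebraic_iff B E F).mpr this).exists_integral_multiple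
    exact ⟨b, hb, Algebra.smul_def b (algebraMap _ F p) ▸ h⟩
end
end

section
/- Let n be a positive integer such that 2⁶ divides n, or p⁵ divides n for some odd prime p. Then there exists a finite group G of order n with B₀(G) ≠ 0. -/
noncomputable section

/-- A 2-cocycle on `G` with values in an abelian group `M` with trivial `G`-action. -/
def IsTwoCocycle {G M : Type*} [Group G] [AddCommGroup M] (f : G → G → M) : Prop :=
  ∀ g h j : G, f h j + f g (h * j) = f (g * h) j + f g h

/-- A 2-coboundary on `G` with values in an abelian group `M` with trivial `G`-action. -/
def IsTwoCoboundary {G M : Type*} [Group G] [AddCommGroup M] (f : G → G → M) : Prop :=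
  ∃ φ : G → M, ∀ g h : G, f g h = φ g + φ h - φ (g * h)

/-- A subgroup `A` of `G` is bicyclic if it is cyclic or the (internal) direct product of two
cyclic subgroups. -/
def IsBicyclic {G : Type*} [Group G] (A : Subgroup G) : Prop :=
  IsCyclic A ∨ ∃ B C : Subgroup G, IsCyclic B ∧ IsCyclic C ∧
    (∀ b ∈ B, ∀ c ∈ C, Commute b c) ∧ B ⊔ C = A ∧ B ⊓ C = ⊥

/-- The Bogomolov multiplier `B₀(G) ⊆ H²(G, ℚ/ℤ)` — the classes of 2-cocycles with values in
`ℚ/ℤ` (trivial `G`-action) whose restriction to every bicyclic subgroup vanishes — is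
nontrivial: there is a 2-cocycle which is not a coboundary on `G` but whose restriction to
every bicyclic subgroup is a coboundary. -/
def HasNontrivialBogomolovMultiplier (G : Type*) [Group G] : Prop :=
  ∃ f : G → G → AddCircle (1 : ℚ), IsTwoCocycle f ∧
    (∀ A : Subgroup G, IsBicyclic A →
      IsTwoCoboundary (fun a b : A => f (a : G) (b : G))) ∧
    ¬ IsTwoCoboundary f

section CentralExtension

open scoped IsMulCommutative commutatorElement

/-- A character of a subgroup of an abelian group extends to the whole group. -/
theorem exists_extend_character {A : Type*} [Group A] [IsMulCommutative A] (K : Subgroup A)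
    (χ : K →* Multiplicative (AddCircle (1 : ℚ))) :
    ∃ ψ : A →* Multiplicative (AddCircle (1 : ℚ)), ∀ k : K, ψ k = χ k := by
  let ι : Additive K →ₗ[ℤ] Additive A := (MonoidHom.toAdditive K.subtype).toIntLinearMap
  have hι : Function.Injective ι := fun a b h => K.subtype_injective h
  obtain ⟨ψ, hψ⟩ := CharacterModule.dual_surjective_of_injective ι hι
    (MonoidHom.toAdditiveLeft χ : Additive K →+ AddCircle (1 : ℚ))
  refine ⟨AddMonoidHom.toMultiplicativeRight (ψ : Additive A →+ AddCircle (1 : ℚ)), fun k => ?_⟩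
  exact DFunLike.congr_fun hψ (Additive.ofMul k)

/-- Characters separate a nontrivial element of an abelian group from the identity. -/
theorem exists_character_ne_one {A : Type*} [Group A] [IsMulCommutative A] {a : A} (ha : a ≠ 1) :
    ∃ χ : A →* Multiplicative (AddCircle (1 : ℚ)), χ a ≠ 1 := by
  obtain ⟨c, hc⟩ := CharacterModule.exists_character_apply_ne_zero_of_ne_zero
    (a := Additive.ofMul a) ha
  exact ⟨AddMonoidHom.toMultiplicativeRight (c : Additive A →+ AddCircle (1 : ℚ)), hc⟩

/-- In a bicyclic subgroup any two elements commute. -/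
theorem IsBicyclic.isMulCommutative {G : Type*} [Group G] {A : Subgroup G} (hA : IsBicyclic A) :
    IsMulCommutative A := by
  rcases hA with hA | ⟨B, C, hB, hC, hBC, rfl, -⟩
  · exact hA.isMulCommutative
  · have hBC' : B ⊔ C = Subgroup.closure (B ∪ C : Set G) := by
      rw [Subgroup.closure_union, Subgroup.closure_eq, Subgroup.closure_eq]
    rw [hBC']
    refine Subgroup.isMulCommutative_closure ?_
    rintro a (ha | ha) b (hb | hb)
    · exact setLike_mul_comm ha hb
    · exact hBC a ha b hb
    · exact (hBC b hb a ha).symm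
    · exact setLike_mul_comm ha hb

/-- A central extension whose kernel contains no nontrivial commutator, but meets the derived
subgroup nontrivially, gives a nontrivial element of the Bogomolov multiplier of the quotient. -/
theorem hasNontrivialBogomolovMultiplier_of_central_extension {E G : Type*} [Group E] [Group G]
    (π : E →* G) (hπ : Function.Surjective π) (hcen : π.ker ≤ Subgroup.center E)
    (hcomm : ∀ x y : E, ⁅x, y⁆ ∈ π.ker → ⁅x, y⁆ = 1)
    {z : E} (hzK : z ∈ π.ker) (hz : z ∈ commutator E) (hz1 : z ≠ 1) :
    HasNontrivialBogomolovMultiplier G := by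
  have hcen' : ∀ k : π.ker, ∀ e : E, e * k = k * e := fun k e =>
    Subgroup.mem_center_iff.1 (hcen k.2) e
  have : IsMulCommutative π.ker := ⟨⟨fun a b => Subtype.ext (hcen' b a)⟩⟩
  obtain ⟨χ, hχ⟩ := exists_character_ne_one (a := (⟨z, hzK⟩ : π.ker))
    (fun h => hz1 (congrArg Subtype.val h))
  obtain ⟨s, hs⟩ : ∃ s : G → E, ∀ g, π (s g) = g := ⟨_, Function.surjInv_eq hπ⟩
  obtain ⟨κ, hκ⟩ : ∃ κ : E → π.ker, ∀ e, (κ e : E) * s (π e) = e :=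
    ⟨fun e => ⟨e * (s (π e))⁻¹, by simp [MonoidHom.mem_ker, hs]⟩, fun e => by simp⟩
  have hκu : ∀ (k : π.ker) (e : E), (k : E) * s (π e) = e → κ e = k := fun k e h =>
    Subtype.ext (mul_right_cancel ((hκ e).trans h.symm))
  have hπκ : ∀ k : π.ker, π k = 1 := fun k => k.2
  have hcκ : ∀ g h, (κ (s g * s h) : E) * s (g * h) = s g * s h := fun g h => by
    simpa [hs] using hκ (s g * s h)
  refine ⟨fun g h => (χ (κ (s g * s h))).toAdd, ?_, ?_, ?_⟩
  · intro g h j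
    simp only [← toAdd_mul, ← map_mul]
    congr 2
    apply Subtype.ext
    apply mul_right_cancel (b := s (g * h * j))
    have e1 : ((κ (s h * s j) * κ (s g * s (h * j)) : π.ker) : E) * s (g * h * j)
        = s g * (s h * s j) := by
      rw [Subgroup.coe_mul, mul_assoc, mul_assoc g h j, hcκ, ← mul_assoc, ← hcen', mul_assoc, hcκ]
    have e2 : ((κ (s (g * h) * s j) * κ (s g * s h) : π.ker) : E) * s (g * h * j)
        = s g * s h * s j := by
      rw [Subgroup.coe_mul, ← hcen', mul_assoc, hcκ, ← mul_assoc, hcκ]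
    rw [e1, e2, mul_assoc]
  · intro A hA
    have := hA.isMulCommutative
    have : IsMulCommutative (A.comap π) := by
      refine ⟨⟨fun a b => Subtype.ext ?_⟩⟩
      have h : ⁅(a : E), (b : E)⁆ = 1 := hcomm _ _ <| by
        rw [MonoidHom.mem_ker, map_commutatorElement, commutatorElement_eq_one_iff_mul_comm]
        exact setLike_mul_comm (Subgroup.mem_comap.1 a.2) (Subgroup.mem_comap.1 b.2)
      exact commutatorElement_eq_one_iff_mul_comm.1 h
    have hle : ∀ k : π.ker, (k : E) ∈ A.comap π := fun k => by
      rw [Subgroup.mem_comap, hπκ]; exact A.one_mem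
    obtain ⟨ψ, hψ⟩ := exists_extend_character (π.ker.subgroupOf (A.comap π))
      (χ.comp (((A.comap π).subtype.comp (Subgroup.subtype _)).codRestrict π.ker
        (fun x => x.2)))
    have hψ' : ∀ k : π.ker, ψ ⟨k, hle k⟩ = χ k := fun k => hψ ⟨⟨k, hle k⟩, k.2⟩
    have hsA : ∀ a : A, s a ∈ A.comap π := fun a => by
      rw [Subgroup.mem_comap, hs]; exact a.2
    refine ⟨fun a => (ψ ⟨s a, hsA a⟩).toAdd, fun a b => ?_⟩
    rw [eq_sub_iff_add_eq]
    beta_reduce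
    rw [← hψ', ← toAdd_mul, ← toAdd_mul, ← map_mul, ← map_mul]
    congr 2
    exact Subtype.ext (hcκ a b)
  · rintro ⟨φ, hφ⟩
    have hmul : ∀ e e', κ (e * e') = κ e * κ e' * κ (s (π e) * s (π e')) := by
      intro e e'
      apply hκu
      rw [Subgroup.coe_mul, mul_assoc, map_mul, hcκ, Subgroup.coe_mul, mul_assoc,
        ← mul_assoc (κ e' : E), ← hcen' (κ e'), mul_assoc, hκ, ← mul_assoc, hκ]
    let ψ : E →* Multiplicative (AddCircle (1 : ℚ)) := MonoidHom.mk'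
      (fun e => χ (κ e) * Multiplicative.ofAdd (φ (π e))) (fun e e' => by
        have h : (χ (κ (s (π e) * s (π e')))).toAdd = _ := hφ (π e) (π e')
        apply Multiplicative.toAdd.injective
        rw [hmul, map_mul χ, map_mul χ, map_mul π, toAdd_mul, toAdd_mul, toAdd_mul, toAdd_mul,
          toAdd_mul, toAdd_mul, h, toAdd_ofAdd, toAdd_ofAdd, toAdd_ofAdd]
        abel)
    have hψ1 : ψ z = 1 := Abelianization.commutator_subset_ker ψ hz
    have hκz : κ z = ⟨z, hzK⟩ * κ 1 := by
      apply hκu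
      rw [Subgroup.coe_mul, mul_assoc, MonoidHom.mem_ker.1 hzK, ← map_one π, hκ, mul_one]
    apply hχ
    have h1 : ψ 1 = χ (κ 1) * Multiplicative.ofAdd (φ (π 1)) := rfl
    have h2 : ψ z = χ ⟨z, hzK⟩ * ψ 1 := by
      change χ (κ z) * Multiplicative.ofAdd (φ (π z)) = _
      rw [h1, hκz, map_mul, MonoidHom.mem_ker.1 hzK, map_one π, mul_assoc]
    rwa [hψ1, map_one, mul_one, eq_comm] at h2

/-- If a finite group `E` has a central element `z` of the derived subgroup such that no
nontrivial power of `z` is a commutator, then every multiple of the order of `E ⧸ ⟨z⟩` is the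
order of a group with nontrivial Bogomolov multiplier. -/
theorem exists_group_of_central_element {E : Type} [Group E] [Finite E] {z : E}
    (hzc : z ∈ Subgroup.center E) (hz : z ∈ commutator E) (hz1 : z ≠ 1)
    (hcomm : ∀ (x y : E) (k : ℕ), ⁅x, y⁆ = z ^ k → z ^ k = 1)
    {n m : ℕ} (hn : 0 < n) (hm : Nat.card E = m * orderOf z) (hmn : m ∣ n) :
    ∃ (G : Type) (_ : Group G) (_ : Fintype G),
      Fintype.card G = n ∧ HasNontrivialBogomolovMultiplier G := by
  obtain ⟨c, rfl⟩ := hmn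
  have hc : 0 < c := Nat.pos_of_mul_pos_left hn
  have : NeZero c := ⟨hc.ne'⟩
  let C := Multiplicative (ZMod c)
  have hzc' : ((z, 1) : E × C) ∈ Subgroup.center (E × C) := by
    rw [Subgroup.mem_center_iff] at hzc ⊢
    rintro ⟨a, b⟩
    simp [hzc a]
  have hle : Subgroup.zpowers ((z, 1) : E × C) ≤ Subgroup.center (E × C) := by
    simpa using hzc'
  have : (Subgroup.zpowers ((z, 1) : E × C)).Normal :=
    ⟨fun k hk g => by
      rw [Subgroup.mem_center_iff.1 (hle hk) g, mul_inv_cancel_right]; exact hk⟩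
  refine ⟨(E × C) ⧸ Subgroup.zpowers ((z, 1) : E × C), inferInstance, Fintype.ofFinite _, ?_, ?_⟩
  · rw [Fintype.card_eq_nat_card]
    have h := Subgroup.card_eq_card_quotient_mul_card_subgroup
      (Subgroup.zpowers ((z, 1) : E × C))
    have hC : Nat.card C = c := by simp [C]
    rw [Nat.card_zpowers, Nat.card_prod, hm, hC, Prod.orderOf_mk, orderOf_one, Nat.lcm_one_right,
      mul_right_comm] at h
    exact (Nat.eq_of_mul_eq_mul_right (orderOf_pos z) h).symm
  · refine hasNontrivialBogomolovMultiplier_of_central_extension (QuotientGroup.mk' _)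
      (QuotientGroup.mk'_surjective _) (by rwa [QuotientGroup.ker_mk']) ?_ (z := (z, 1)) ?_ ?_ ?_
    · rintro ⟨x, x'⟩ ⟨y, y'⟩ h
      rw [QuotientGroup.ker_mk', ← mem_powers_iff_mem_zpowers, Submonoid.mem_powers_iff] at h
      obtain ⟨k, hk⟩ := h
      have h1 : ⁅x, y⁆ = z ^ k := (congrArg Prod.fst hk).symm
      have h2 := hcomm x y k h1
      rw [← hk, Prod.pow_mk, h2, one_pow]
      rfl
    · rw [QuotientGroup.ker_mk']; exact Subgroup.mem_zpowers _
    · have := Subgroup.mem_map_of_mem (MonoidHom.inl E C) hz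
      exact Subgroup.map_le_iff_le_comap.2 (Subgroup.commutator_le.2 fun a _ b _ => by
        simpa only [Subgroup.mem_comap, map_commutatorElement, commutator_def] using
          Subgroup.commutator_mem_commutator (Subgroup.mem_top _) (Subgroup.mem_top _)) this
    · exact fun h => hz1 (congrArg Prod.fst h)

end CentralExtension

/-- A group `Q` acting on an additive group `R` and preserving an `F`-valued biadditive form. -/
structure FormAction (R F Q : Type*) [AddCommGroup R] [AddCommGroup F] [Group Q] where
  /-- The action of `Q` on `R`. -/
  act : Q →* AddMonoid.End R
  /-- The form on `R`. -/
  form : R → R → F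
  form_add_left : ∀ a b c, form (a + b) c = form a c + form b c
  form_add_right : ∀ a b c, form a (b + c) = form a b + form a c
  form_act : ∀ q a b, form (act q a) (act q b) = form a b

namespace FormAction

variable {R F Q : Type*} [AddCommGroup R] [AddCommGroup F] [Group Q]

/-- The semidirect product by `Q` of the central extension of `R` by `F` given by the form. -/
@[ext] structure Total (D : FormAction R F Q) where
  /-- The component in `R`. -/
  base : R
  /-- The component in `F`. -/
  fibre : F
  /-- The component in `Q`. -/
  top : Q

variable (D : FormAction R F Q)

theorem form_zero_left (a : R) : D.form 0 a = 0 := by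
  simpa using D.form_add_left 0 0 a

theorem form_neg_left (a b : R) : D.form (-a) b = -D.form a b := by
  rw [eq_neg_iff_add_eq_zero, ← D.form_add_left, neg_add_cancel, form_zero_left]

namespace Total

variable {D}

instance : Mul D.Total :=
  ⟨fun x y => ⟨x.base + D.act x.top y.base, x.fibre + y.fibre + D.form x.base (D.act x.top y.base),
    x.top * y.top⟩⟩

instance : One D.Total := ⟨⟨0, 0, 1⟩⟩

instance : Inv D.Total :=
  ⟨fun x => ⟨-D.act x.top⁻¹ x.base, -x.fibre + D.form x.base x.base, x.top⁻¹⟩⟩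

@[simp] theorem mul_base (x y : D.Total) : (x * y).base = x.base + D.act x.top y.base := rfl

@[simp] theorem mul_fibre (x y : D.Total) :
    (x * y).fibre = x.fibre + y.fibre + D.form x.base (D.act x.top y.base) := rfl

@[simp] theorem mul_top (x y : D.Total) : (x * y).top = x.top * y.top := rfl

@[simp] theorem one_base : (1 : D.Total).base = 0 := rfl

@[simp] theorem one_fibre : (1 : D.Total).fibre = 0 := rfl

@[simp] theorem one_top : (1 : D.Total).top = 1 := rfl

@[simp] theorem inv_base (x : D.Total) : (x⁻¹).base = -D.act x.top⁻¹ x.base := rfl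

@[simp] theorem inv_fibre (x : D.Total) : (x⁻¹).fibre = -x.fibre + D.form x.base x.base := rfl

@[simp] theorem inv_top (x : D.Total) : (x⁻¹).top = x.top⁻¹ := rfl

instance : Group D.Total :=
  Group.ofLeftAxioms
    (fun x y z => by
      ext
      · simp [add_assoc]
      · simp only [mul_base, mul_fibre, mul_top, map_add, map_mul, AddMonoid.End.coe_mul,
          Function.comp_apply, D.form_add_left, D.form_add_right, D.form_act]
        abel
      · simp [mul_assoc])
    (fun x => by ext <;> simp [form_zero_left])
    (fun x => by
      ext
      · simp
      · simp only [mul_fibre, inv_base, inv_fibre, inv_top, one_fibre, D.form_neg_left, D.form_act]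
        abel
      · simp)

variable (D) in
/-- The underlying set of the group. -/
def equivProd : D.Total ≃ R × F × Q where
  toFun x := (x.base, x.fibre, x.top)
  invFun x := ⟨x.1, x.2.1, x.2.2⟩

instance [Finite R] [Finite F] [Finite Q] : Finite D.Total := .of_equiv _ (equivProd D).symm

variable (D) in
theorem card_eq : Nat.card D.Total = Nat.card R * (Nat.card F * Nat.card Q) := by
  rw [Nat.card_congr (equivProd D), Nat.card_prod, Nat.card_prod]

/-- An element of `R` in the radical of the form and fixed by `Q` gives a central element. -/
theorem mem_center {w : R} (f : F) (hact : ∀ q, D.act q w = w) (hl : ∀ a, D.form w a = 0)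
    (hr : ∀ a, D.form a w = 0) : (⟨w, f, 1⟩ : D.Total) ∈ Subgroup.center D.Total := by
  rw [Subgroup.mem_center_iff]
  intro x
  ext
  · simp [hact, add_comm]
  · simp [hact, hl, hr, add_comm]
  · simp

theorem pow_eq {w : R} (f : F) (hl : ∀ a, D.form w a = 0) (k : ℕ) :
    (⟨w, f, 1⟩ : D.Total) ^ k = ⟨k • w, k • f, 1⟩ := by
  induction k with
  | zero => ext <;> simp
  | succ k ih => rw [pow_succ', ih]; ext <;> simp [hl, succ_nsmul']

end Total

end FormAction

/-- The sign character used in the action of the dihedral group on `ℤ/8`. -/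
def dihedralUnit : DihedralGroup 4 → ZMod 8
  | .r i => if i = 0 ∨ i = 2 then 1 else 7
  | .sr i => if i = 0 ∨ i = 2 then 3 else 5

/-- The additive part of the action of the dihedral group. -/
def dihedralShift : DihedralGroup 4 → ZMod 2
  | .r _ => 0
  | .sr _ => 1

/-- The endomorphism `(x, e) ↦ (u x, e + q x)` of `ℤ/8 × ℤ/2` attached to an element of the
dihedral group. -/
def dihedralEnd (v : DihedralGroup 4) : AddMonoid.End (ZMod 8 × ZMod 2) where
  toFun x := (dihedralUnit v * x.1, x.2 + dihedralShift v * x.1.cast)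
  map_zero' := by revert v; decide +kernel
  map_add' := by revert v; decide +kernel

/-- The dihedral group acting on `ℤ/8 × ℤ/2`, with the zero form. -/
def dihedralAction : FormAction (ZMod 8 × ZMod 2) PUnit.{1} (DihedralGroup 4) where
  act :=
    { toFun := dihedralEnd
      map_one' := by
        have h : ∀ x, dihedralEnd 1 x = x := by decide +kernel
        exact AddMonoidHom.ext h
      map_mul' := by
        have h : ∀ v w x, dihedralEnd (v * w) x = dihedralEnd v (dihedralEnd w x) := by
          decide +kernel
        exact fun v w => AddMonoidHom.ext (h v w) }
  form _ _ := 0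
  form_add_left _ _ _ := rfl
  form_add_right _ _ _ := rfl
  form_act _ _ _ := rfl

/-- The central element `(0, 1)` of the extension of the dihedral group. -/
def dihedralCentral : dihedralAction.Total := ⟨(0, 1), PUnit.unit, 1⟩

open scoped commutatorElement in
theorem exists_group_of_two_pow_dvd {n : ℕ} (hn : 0 < n) (h : 2 ^ 6 ∣ n) :
    ∃ (G : Type) (_ : Group G) (_ : Fintype G),
      Fintype.card G = n ∧ HasNontrivialBogomolovMultiplier G := by
  have hpow : ∀ k : ℕ, dihedralCentral ^ k = ⟨k • (0, 1), k • PUnit.unit, 1⟩ := fun k =>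
    FormAction.Total.pow_eq PUnit.unit (fun _ => rfl) k
  have hne : dihedralCentral ≠ 1 := fun h => by
    have := congrArg (fun x : dihedralAction.Total => x.base.2) h
    exact absurd this (by decide +kernel)
  have hord : orderOf dihedralCentral = 2 :=
    orderOf_eq_prime (by rw [hpow]; ext <;> rfl) hne
  have hcomm : ∀ v w : DihedralGroup 4, v * w = w * v → ∀ x y : ZMod 8,
      x + dihedralUnit v * y = y + dihedralUnit w * x →
      dihedralShift v * y.cast = dihedralShift w * (x.cast : ZMod 2) := by
    decide +kernel
  refine exists_group_of_central_element (z := dihedralCentral)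
    (FormAction.Total.mem_center _ (by decide +kernel) (fun _ => rfl) (fun _ => rfl)) ?_ hne ?_ hn
    (m := 2 ^ 6) ?_ h
  · have hc : dihedralCentral =
        ⁅(⟨0, 0, .sr 0⟩ : dihedralAction.Total), (⟨(2, 0), 0, 1⟩ : dihedralAction.Total)⁆ *
          ⁅(⟨0, 0, .sr 1⟩ : dihedralAction.Total), (⟨(1, 0), 0, 1⟩ : dihedralAction.Total)⁆ := by
      simp only [commutatorElement_def]
      ext
      · decide +kernel
      · decide +kernel
      · decide +kernel
    rw [hc, commutator_def]
    exact mul_mem (Subgroup.commutator_mem_commutator (Subgroup.mem_top _) (Subgroup.mem_top _))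
      (Subgroup.commutator_mem_commutator (Subgroup.mem_top _) (Subgroup.mem_top _))
  · rintro ⟨⟨x, e⟩, _, v⟩ ⟨⟨y, e'⟩, _, w⟩ k h
    rw [commutatorElement_def, mul_inv_eq_iff_eq_mul, mul_inv_eq_iff_eq_mul, hpow] at h
    have ht : v * w = w * v := by simpa [mul_assoc] using congrArg (fun x => x.top) h
    have hb : ((x, e) : ZMod 8 × ZMod 2) + dihedralEnd v (y, e') =
      k • (0, 1) + ((y, e') + dihedralEnd w (x, e)) := by
      have h0 : ((x, e) : ZMod 8 × ZMod 2) + dihedralAction.act v (y, e') =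
          k • (0, 1) + dihedralAction.act 1 ((y, e') + dihedralAction.act w (x, e)) := by
        simpa [mul_assoc] using congrArg (fun x => x.base) h
      rwa [map_one] at h0
    have h1 : x + dihedralUnit v * y = y + dihedralUnit w * x := by
      have h0 : x + dihedralUnit v * y = k • 0 + (y + dihedralUnit w * x) :=
        congrArg Prod.fst hb
      rwa [smul_zero, zero_add] at h0
    have h2 : e + (e' + dihedralShift v * y.cast) = k • 1 + (e' + (e + dihedralShift w * x.cast)) :=
      congrArg Prod.snd hb
    have h3 : k • (1 : ZMod 2) = 0 := by
      rw [hcomm v w ht x y h1] at h2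
      linear_combination -h2
    rw [hpow]
    ext
    · simp
    · simpa using h3
    · rfl
  · rw [hord, FormAction.Total.card_eq]
    simp [DihedralGroup.card]

/-- The determinant form `(r, r') ↦ a r * b r' - b r * a r'` preserved by a group of automorphisms
generated by `u` with `a ∘ u = a` and `b ∘ u = b + a`. -/
def detAction {R A : Type*} [AddCommGroup R] [CommRing A] (u : (AddMonoid.End R)ˣ) (a b : R →+ A)
    (ha : ∀ r, a (u.1 r) = a r) (hb : ∀ r, b (u.1 r) = b r + a r) :
    FormAction R A (Subgroup.zpowers u) where
  act := (Units.coeHom _).comp (Subgroup.subtype _)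
  form r r' := a r * b r' - b r * a r'
  form_add_left r r' r'' := by simp only [map_add]; ring
  form_add_right r r' r'' := by simp only [map_add]; ring
  form_act q r r' := by
    have hstep : ∀ r r', a (u.1 r) * b (u.1 r') - b (u.1 r) * a (u.1 r') =
        a r * b r' - b r * a r' := fun r r' => by simp only [ha, hb]; ring
    have hinv : ∀ r, u.1 (u⁻¹.1 r) = r := fun r => DFunLike.congr_fun u.mul_inv r
    have hpow : ∀ (k : ℤ) (r r' : R), a ((u ^ k).1 r) * b ((u ^ k).1 r') -
        b ((u ^ k).1 r) * a ((u ^ k).1 r') = a r * b r' - b r * a r' := by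
      intro k
      induction k with
      | zero => intro r r'; rw [zpow_zero]; rfl
      | succ k ih =>
        intro r r'
        rw [zpow_add_one]
        exact (ih (u.1 r) (u.1 r')).trans (hstep r r')
      | pred k ih =>
        intro r r'
        rw [zpow_sub_one]
        refine (ih (u⁻¹.1 r) (u⁻¹.1 r')).trans ?_
        rw [← hstep, hinv, hinv]
    obtain ⟨_, k, rfl⟩ := q
    exact hpow k r r'

open scoped commutatorElement in
/-- A unipotent automorphism `u` of order `p` of a group of order `p ^ 4`, together with its first
two coordinates `a`, `b` and a fixed vector `w`, yields groups with nontrivial Bogomolov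
multiplier. -/
theorem exists_group_of_unipotent {p : ℕ} [Fact p.Prime] (hodd : Odd p) {R : Type}
    [AddCommGroup R] (hR : Nat.card R = p ^ 4) (u : (AddMonoid.End R)ˣ) (hu : u ^ p = 1)
    (a b : R →+ ZMod p) (ha : ∀ r, a (u.1 r) = a r) (hb : ∀ r, b (u.1 r) = b r + a r)
    {w : R} (hw : p • w = 0) (hw0 : w ≠ 0) (huw : u.1 w = w)
    (hker : ∀ (r : R) (k : ℕ), u.1 r = r + k • w → a r = 0 ∧ b r = 0)
    {e r₀ r₁ : R} (he : u.1 e = e + w) (har₀ : a r₀ = 1) (hbr₀ : b r₀ = 0) (har₁ : a r₁ = 0)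
    (hbr₁ : b r₁ = 1) {n : ℕ} (hn : 0 < n) (h : p ^ 5 ∣ n) :
    ∃ (G : Type) (_ : Group G) (_ : Fintype G),
      Fintype.card G = n ∧ HasNontrivialBogomolovMultiplier G := by
  have hp : p.Prime := Fact.out
  have hfinR : Finite R := Nat.finite_of_card_ne_zero (by rw [hR]; exact pow_ne_zero _ hp.ne_zero)
  have hu1 : u ≠ 1 := by
    rintro rfl
    have := hb r₀
    rw [har₀, Units.val_one, AddMonoid.End.one_apply, left_eq_add] at this
    exact one_ne_zero this
  have hord : orderOf u = p := orderOf_eq_prime hu hu1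
  have hQ : Nat.card (Subgroup.zpowers u) = p := by rw [Nat.card_zpowers, hord]
  have hfinQ : Finite (Subgroup.zpowers u) :=
    Nat.finite_of_card_ne_zero (by rw [hQ]; exact hp.ne_zero)
  have hgen : ∀ q q' : Subgroup.zpowers u, q ≠ 1 → ∃ j : ℕ, q ^ j = q' := fun q q' hq =>
    (Submonoid.mem_powers_iff _ _).1
      (mem_powers_iff_mem_zpowers.2 (mem_zpowers_of_prime_card hQ hq))
  let D := detAction u a b ha hb
  have hform : ∀ r r', D.form r r' = a r * b r' - b r * a r' := fun _ _ => rfl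
  have hab : a w = 0 ∧ b w = 0 := hker w 0 (by rw [huw, zero_smul, add_zero])
  have hl : ∀ r, D.form w r = 0 := fun r => by rw [hform, hab.1, hab.2]; ring
  have hr : ∀ r, D.form r w = 0 := fun r => by rw [hform, hab.1, hab.2]; ring
  have hact : ∀ q, D.act q w = w := by
    have hug : D.act ⟨u, Subgroup.mem_zpowers u⟩ w = w := huw
    intro q
    have hu1' : (⟨u, Subgroup.mem_zpowers u⟩ : Subgroup.zpowers u) ≠ 1 :=
      fun h => hu1 (congrArg Subtype.val h)
    obtain ⟨j, rfl⟩ := hgen _ q hu1'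
    induction j with
    | zero => rw [pow_zero, map_one]; rfl
    | succ j ih => rw [pow_succ, map_mul, AddMonoid.End.coe_mul, Function.comp_apply, hug, ih]
  let z : D.Total := ⟨w, 1, 1⟩
  have hpow : ∀ k : ℕ, z ^ k = ⟨k • w, k • 1, 1⟩ := FormAction.Total.pow_eq 1 hl
  have hzero : ∀ k : ℕ, (k : ZMod p) = 0 → z ^ k = 1 := by
    intro k hk
    obtain ⟨c, rfl⟩ := (ZMod.natCast_eq_zero_iff k p).1 hk
    rw [hpow]
    ext
    · change (p * c) • w = 0
      rw [mul_comm, mul_smul, hw, smul_zero]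
    · simp
    · rfl
  have hz1 : z ≠ 1 := fun h => hw0 (congrArg (fun x => x.base) h)
  have hzord : orderOf z = p := orderOf_eq_prime (hzero p (by simp)) hz1
  have hzc : z ∈ Subgroup.center D.Total := FormAction.Total.mem_center 1 hact hl hr
  -- a commutator whose second entry lies over the identity
  have hone : ∀ (x y : D.Total) (k : ℕ), x.top ≠ 1 → y.top = 1 → x * y = z ^ k * (y * x) →
      (k : ZMod p) = 0 := by
    intro x y k hx hy hxy
    have h1 : D.act x.top y.base = y.base + k • w := by
      have := congrArg (fun x => x.base) hxy
      simp only [hpow, FormAction.Total.mul_base, hy, map_one, AddMonoid.End.one_apply] at this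
      exact add_left_cancel (a := x.base) (this.trans (by abel))
    obtain ⟨j, hj⟩ := hgen _ ⟨u, Subgroup.mem_zpowers u⟩ hx
    have h2 : ∀ j : ℕ, D.act (x.top ^ j) y.base = y.base + (j * k) • w := by
      intro j
      induction j with
      | zero => simp
      | succ j ih =>
        rw [pow_succ', map_mul, AddMonoid.End.coe_mul, Function.comp_apply, ih, map_add, h1,
          map_nsmul, hact, add_mul, add_smul, one_mul]
        abel
    have h3 := h2 j
    rw [hj] at h3
    obtain ⟨ha0, hb0⟩ := hker y.base (j * k) h3
    have h4 := congrArg (fun x => x.fibre) hxy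
    simp only [hpow, FormAction.Total.mul_fibre, hy, map_one, AddMonoid.End.one_apply, hform, h1,
      map_add, map_nsmul, ha0, hb0, hab.1, hab.2] at h4
    simp at h4
    linear_combination -h4
  have hcentral : ∀ (k : ℕ) (x : D.Total), x * z ^ k = z ^ k * x := fun k =>
    Subgroup.mem_center_iff.1 (pow_mem hzc k)
  -- a commutator whose first entry does not lie over the identity
  have htwo : ∀ (x y : D.Total) (k : ℕ), x.top ≠ 1 → ⁅x, y⁆ = z ^ k → (k : ZMod p) = 0 := by
    intro x y k hx hxy
    rw [commutatorElement_def, mul_inv_eq_iff_eq_mul, mul_inv_eq_iff_eq_mul, mul_assoc] at hxy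
    obtain ⟨j, hj⟩ := hgen _ (y.top⁻¹) hx
    have htop : ∀ j : ℕ, (x ^ j).top = x.top ^ j := by
      intro j
      induction j with
      | zero => rfl
      | succ j ih => rw [pow_succ, pow_succ, FormAction.Total.mul_top, ih]
    refine hone x (y * x ^ j) k hx ?_ ?_
    · rw [FormAction.Total.mul_top, htop, hj, mul_inv_cancel]
    · rw [← mul_assoc, hxy, mul_assoc, mul_assoc, mul_assoc, ← pow_succ, ← pow_succ']
  refine exists_group_of_central_element (z := z) hzc ?_ hz1 ?_ hn (m := p ^ 5) ?_ h
  · obtain ⟨m, hm⟩ := hodd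
    have hm' : (2 * (-m : ZMod p)) = 1 := by
      have : ((2 * m + 1 : ℕ) : ZMod p) = 0 := by rw [← hm]; simp
      push_cast at this
      linear_combination -this
    obtain ⟨c, hc⟩ : ∃ c : ℕ, (c : ZMod p) = -m := ⟨(-m : ZMod p).val, by simp⟩
    rw [← hc] at hm'
    obtain ⟨hae, hbe⟩ := hker e 1 (by rw [he, one_smul])
    let U : D.Total := ⟨0, 0, ⟨u, Subgroup.mem_zpowers u⟩⟩
    let V : D.Total := ⟨e, 0, 1⟩
    let X : D.Total := ⟨r₀, 0, 1⟩
    let Y : D.Total := ⟨c • r₁, 0, 1⟩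
    have h1 : ⁅U, V⁆ = ⟨w, 0, 1⟩ := by
      rw [commutatorElement_def, mul_inv_eq_iff_eq_mul, mul_inv_eq_iff_eq_mul]
      ext
      · have h0 : D.act ⟨u, Subgroup.mem_zpowers u⟩ e = e + w := he
        simp [U, V, h0, add_comm]
      · simp [U, V, hform, hae, hbe, hab.1, hab.2]
      · simp [U, V]
    have h2 : ⁅X, Y⁆ = ⟨0, 1, 1⟩ := by
      rw [commutatorElement_def, mul_inv_eq_iff_eq_mul, mul_inv_eq_iff_eq_mul]
      ext
      · simp [X, Y, add_comm]
      · simp [X, Y, hform, har₀, har₁, hbr₀, hbr₁]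
        linear_combination hm'
      · simp [X, Y]
    have h3 : z = ⁅U, V⁆ * ⁅X, Y⁆ := by
      rw [h1, h2]
      ext <;> simp [z, hform]
    rw [h3, commutator_def]
    exact mul_mem (Subgroup.commutator_mem_commutator (Subgroup.mem_top _) (Subgroup.mem_top _))
      (Subgroup.commutator_mem_commutator (Subgroup.mem_top _) (Subgroup.mem_top _))
  · intro x y k hxy
    by_cases hx : x.top = 1
    · by_cases hy : y.top = 1
      · rw [commutatorElement_def, mul_inv_eq_iff_eq_mul, mul_inv_eq_iff_eq_mul, mul_assoc] at hxy
        have h1 := congrArg (fun x => x.base) hxy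
        simp only [hpow, FormAction.Total.mul_base, hx, hy, map_one, AddMonoid.End.one_apply] at h1
        have h2 : k • w = 0 := by
          rw [add_comm x.base, eq_comm, add_eq_right] at h1
          exact h1
        refine hzero k ((ZMod.natCast_eq_zero_iff k p).2 ?_)
        rw [← addOrderOf_eq_prime hw hw0]
        exact addOrderOf_dvd_of_nsmul_eq_zero h2
      · have h1 : ⁅y, x⁆ = z ^ (k * (p - 1)) := by
          rw [← commutatorElement_inv, hxy, inv_eq_iff_mul_eq_one, ← pow_add]
          apply hzero
          have : k + k * (p - 1) = k * p := by
            obtain ⟨m, rfl⟩ := Nat.exists_eq_add_of_le hp.one_le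
            rw [Nat.add_sub_cancel_left]; ring
          rw [this]; simp
        have h2 := htwo y x _ hy h1
        refine hzero k ?_
        rw [Nat.cast_mul, Nat.cast_sub hp.one_le] at h2
        simpa using h2
    · exact hzero k (htwo x y k hx hxy)
  · rw [hzord, FormAction.Total.card_eq, hR, hQ, Nat.card_zmod]
    ring

/-- The unipotent automorphism of `(ℤ/p)⁴` with a single Jordan block. -/
def jordanUnit (p : ℕ) : (AddMonoid.End (ZMod p × ZMod p × ZMod p × ZMod p))ˣ where
  val := AddMonoidHom.mk' (fun x => (x.1, x.2.1 + x.1, x.2.2.1 + x.2.1, x.2.2.2 + x.2.2.1))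
    fun x y => by ext <;> simp <;> ring
  inv := AddMonoidHom.mk' (fun x => (x.1, x.2.1 - x.1, x.2.2.1 - x.2.1 + x.1,
    x.2.2.2 - x.2.2.1 + x.2.1 - x.1)) fun x y => by ext <;> simp <;> ring
  val_inv := by
    refine AddMonoidHom.ext fun x => ?_
    change (_, _, _, _) = (_, _, _, _)
    simp only [AddMonoidHom.mk'_apply]
    ext <;> simp
  inv_val := by
    refine AddMonoidHom.ext fun x => ?_
    change (_, _, _, _) = (_, _, _, _)
    simp only [AddMonoidHom.mk'_apply]
    ext <;> simp <;> ring

theorem jordanUnit_apply {p : ℕ} (x : ZMod p × ZMod p × ZMod p × ZMod p) :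
    (jordanUnit p).1 x = (x.1, x.2.1 + x.1, x.2.2.1 + x.2.1, x.2.2.2 + x.2.2.1) := rfl

theorem jordanUnit_pow_apply {p : ℕ} (n : ℕ) (x : ZMod p × ZMod p × ZMod p × ZMod p) :
    (jordanUnit p ^ n).1 x = (x.1, x.2.1 + n * x.1, x.2.2.1 + n * x.2.1 + n.choose 2 * x.1,
      x.2.2.2 + n * x.2.2.1 + n.choose 2 * x.2.1 + n.choose 3 * x.1) := by
  induction n with
  | zero => simp
  | succ n ih =>
    rw [pow_succ', Units.val_mul, AddMonoid.End.coe_mul, Function.comp_apply, ih, jordanUnit_apply,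
      Nat.choose_succ_succ' n 1, Nat.choose_succ_succ' n 2, Nat.choose_one_right]
    ext <;> push_cast <;> ring

theorem jordanUnit_pow_prime {p : ℕ} (hp : p.Prime) (h3 : 3 < p) : jordanUnit p ^ p = 1 := by
  have h : ∀ k, k ≠ 0 → k < p → ((p.choose k : ℕ) : ZMod p) = 0 := fun k hk hkp =>
    (ZMod.natCast_eq_zero_iff _ _).2 (hp.dvd_choose_self hk hkp)
  refine Units.ext (AddMonoidHom.ext fun x => ?_)
  refine (jordanUnit_pow_apply p x).trans ?_
  rw [h 2 two_ne_zero (by lia), h 3 three_ne_zero h3]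
  simp only [CharP.cast_eq_zero, zero_mul, add_zero]
  rfl

/-- Multiplication by a primitive cube root of unity on `ℤ[ω]/9`. -/
def eisensteinUnit : (AddMonoid.End (ZMod 9 × ZMod 9))ˣ where
  val := AddMonoidHom.mk' (fun x => (-x.2, x.1 - x.2)) fun x y => by ext <;> simp <;> ring
  inv := AddMonoidHom.mk' (fun x => (x.2 - x.1, -x.1)) fun x y => by ext <;> simp <;> ring
  val_inv := AddMonoidHom.ext (by decide +kernel)
  inv_val := AddMonoidHom.ext (by decide +kernel)

/-- The reduction of `ℤ[ω]/9` modulo `ω - 1`. -/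
def eisensteinFst : ZMod 9 × ZMod 9 →+ ZMod 3 :=
  AddMonoidHom.mk' (fun x => (x.1 + x.2).cast) (by decide +kernel)

/-- The second coordinate of `ℤ[ω]/9` modulo `(ω - 1) ^ 2` in the basis `1, ω - 1`. -/
def eisensteinSnd : ZMod 9 × ZMod 9 →+ ZMod 3 :=
  AddMonoidHom.mk' (fun x => x.2.cast) (by decide +kernel)

theorem eisenstein_ker : ∀ (r : ZMod 9 × ZMod 9) (k : ZMod 9),
    eisensteinUnit.1 r = r + (k * 3, k * 6) → eisensteinFst r = 0 ∧ eisensteinSnd r = 0 := by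
  decide +kernel

theorem exists_group_of_odd_prime_pow_dvd {p n : ℕ} (hp : p.Prime) (hodd : Odd p) (hn : 0 < n)
    (h : p ^ 5 ∣ n) :
    ∃ (G : Type) (_ : Group G) (_ : Fintype G),
      Fintype.card G = n ∧ HasNontrivialBogomolovMultiplier G := by
  have hfact : Fact p.Prime := ⟨hp⟩
  have hp2 : p ≠ 2 := by rintro rfl; exact absurd hodd (by decide)
  obtain rfl | h3 : p = 3 ∨ 3 < p := by have := hp.two_le; lia
  · refine exists_group_of_unipotent (R := ZMod 9 × ZMod 9) hodd (by simp) eisensteinUnit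
      (Units.ext (AddMonoidHom.ext (by decide +kernel)))
      eisensteinFst eisensteinSnd (by decide +kernel)
      (by decide +kernel) (w := (3, 6)) (by decide +kernel) (by decide +kernel) (by decide +kernel)
      ?_ (e := (6, 0)) (r₀ := (1, 0)) (r₁ := (8, 1)) (by decide +kernel) (by decide +kernel)
      (by decide +kernel) (by decide +kernel) (by decide +kernel) hn h
    intro r k hk
    exact eisenstein_ker r k (hk.trans (by simp))
  · refine exists_group_of_unipotent (R := ZMod p × ZMod p × ZMod p × ZMod p) hodd ?_
      (jordanUnit p) (jordanUnit_pow_prime hp h3) (AddMonoidHom.fst _ _)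
      ((AddMonoidHom.fst _ _).comp (AddMonoidHom.snd _ _)) (fun _ => rfl) (fun _ => rfl)
      (w := (0, 0, 0, 1)) (by simp) (by simp) (by simp [jordanUnit_apply]) ?_
      (e := (0, 0, 1, 0)) (r₀ := (1, 0, 0, 0)) (r₁ := (0, 1, 0, 0)) (by simp [jordanUnit_apply])
      rfl rfl rfl rfl hn h
    · simp only [Nat.card_prod, Nat.card_zmod]; ring
    · intro r k hk
      rw [jordanUnit_apply] at hk
      have h1 := congrArg (fun x => x.2.1) hk
      have h2 := congrArg (fun x => x.2.2.1) hk
      exact ⟨by simpa using h1, by simpa using h2⟩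

/-- **Hoshi–Kang–Kunyavskii.** If `2⁶ ∣ n`, or `p⁵ ∣ n` for some odd prime `p`, then there
exists a group `G` of order `n` with nontrivial Bogomolov multiplier `B₀(G) ≠ 0`. -/
theorem exists_group_with_nontrivial_bogomolov_multiplier
    (n : ℕ) (hn : 0 < n)
    (hdvd : 2 ^ 6 ∣ n ∨ ∃ p : ℕ, p.Prime ∧ Odd p ∧ p ^ 5 ∣ n) :
    ∃ (G : Type) (_ : Group G) (_ : Fintype G),
      Fintype.card G = n ∧ HasNontrivialBogomolovMultiplier G := by
  obtain h | ⟨p, hp, hodd, h⟩ := hdvd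
  · exact exists_group_of_two_pow_dvd hn h
  · exact exists_group_of_odd_prime_pow_dvd hp hodd hn h
end
end
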